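/- arXiv:1501.01198 — 7 statements merged into one kernel-verified Lean document; each statement's English description precedes it below -/
import Mathlib

section
/- For every radius ρ > 0 there exist a finite-index subgroup Γ of ℤ² and a point t ∈ ℤ² such that for every g ∈ Γ the ball B_ρ(t+g) contains no visible point, i.e. V ∩ B_ρ(t+g) = ∅. In particular, V contains holes of arbitrary size that repeat lattice-periodically, so V is not relatively dense in ℝ². -/
open Filter Topology

/-- The set of visible points of the square lattice `ℤ²`. -/
def Vis : Set (ℤ × ℤ) := {x | Int.gcd x.1 x.2 = 1}

theorem crt_aux (M : ℕ) (p : ℕ × ℕ → ℕ) (hp : ∀ k, (p k).Prime) (hinj : Function.Injective p)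
    (f : ℕ × ℕ → ℕ) : ∃ t : ℕ, ∀ k ∈ Finset.range M ×ˢ Finset.range M, p k ∣ t + f k := by
  obtain ⟨t, ht⟩ := Nat.chineseRemainderOfFinset (fun k => (p k - 1) * f k) p
    (Finset.range M ×ˢ Finset.range M) (fun k _ => (hp k).ne_zero)
    (fun a _ b _ hab => (Nat.coprime_primes (hp a) (hp b)).2 (fun h => hab (hinj h)))
  refine ⟨t, fun k hk => ?_⟩
  have h := (ht k hk).add_right (f k)
  have h2 : (p k - 1) * f k + f k = p k * f k := by
    have := (hp k).one_le
    obtain ⟨q, hq⟩ := Nat.exists_eq_add_of_le this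
    rw [hq]; simp; ring
  rw [h2] at h
  exact (Nat.modEq_zero_iff_dvd.1 (h.trans (Nat.modEq_zero_iff_dvd.2 (dvd_mul_right _ _))))

theorem holes_aux (ρ : ℝ) (hρ : 0 < ρ) :
    ∃ (Γ : AddSubgroup (ℤ × ℤ)) (t : ℤ × ℤ), Γ.FiniteIndex ∧
      ∀ g ∈ Γ, ∀ v ∈ Vis,
        ¬ (((v.1 : ℝ) - ((t.1 : ℝ) + (g.1 : ℝ)))^2 +
           ((v.2 : ℝ) - ((t.2 : ℝ) + (g.2 : ℝ)))^2 < ρ^2) := by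
  obtain ⟨N, hN⟩ := exists_nat_ge ρ
  let p : ℕ × ℕ → ℕ := fun k => Nat.nth Nat.Prime (Nat.pair k.1 k.2)
  have hp : ∀ k, (p k).Prime := fun k => Nat.prime_nth_prime _
  have hinj : Function.Injective p := by
    intro a b h
    have h1 := Nat.nth_injective Nat.infinite_setOf_prime h
    have h2 := Nat.pair_eq_pair.1 h1
    exact Prod.ext h2.1 h2.2
  obtain ⟨t1, h1⟩ := crt_aux (2 * N + 1) p hp hinj Prod.fst
  obtain ⟨t2, h2⟩ := crt_aux (2 * N + 1) p hp hinj Prod.snd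
  let P : ℕ := ∏ k ∈ Finset.range (2 * N + 1) ×ˢ Finset.range (2 * N + 1), p k
  have hP : P ≠ 0 := Finset.prod_ne_zero_iff.2 fun k _ => (hp k).ne_zero
  refine ⟨(AddSubgroup.zmultiples (P : ℤ)).prod (AddSubgroup.zmultiples (P : ℤ)),
    ((t1 : ℤ) + N, (t2 : ℤ) + N), ⟨?_⟩, ?_⟩
  · rw [AddSubgroup.index_prod, Int.index_zmultiples]
    simpa using hP
  · rintro ⟨g1, g2⟩ hg ⟨v1, v2⟩ hv hlt
    rw [AddSubgroup.mem_prod] at hg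
    obtain ⟨hg1, hg2⟩ := hg
    rw [Int.mem_zmultiples_iff] at hg1 hg2
    simp only at hg1 hg2 hlt
    push_cast at hlt
    have bd : ∀ x y : ℝ, x ^ 2 + y ^ 2 < ρ ^ 2 → |x| < N := fun x y h =>
      lt_of_lt_of_le (abs_lt_of_sq_lt_sq (by nlinarith [sq_nonneg y]) hρ.le) hN
    have b1 := abs_lt.1 (bd _ _ hlt)
    have b2 := abs_lt.1 (bd _ _ (by rw [add_comm]; exact hlt))
    have c1 : (t1 : ℤ) + g1 < v1 := by
      have := b1.1
      exact_mod_cast (by linarith : (t1 : ℝ) + g1 < v1)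
    have c2 : v1 < (t1 : ℤ) + g1 + 2 * N := by
      have := b1.2
      exact_mod_cast (by linarith : (v1 : ℝ) < t1 + g1 + 2 * N)
    have c3 : (t2 : ℤ) + g2 < v2 := by
      have := b2.1
      exact_mod_cast (by linarith : (t2 : ℝ) + g2 < v2)
    have c4 : v2 < (t2 : ℤ) + g2 + 2 * N := by
      have := b2.2
      exact_mod_cast (by linarith : (v2 : ℝ) < t2 + g2 + 2 * N)
    obtain ⟨i, hi⟩ := Int.eq_ofNat_of_zero_le (show 0 ≤ v1 - (t1 + g1) by omega)
    obtain ⟨j, hj⟩ := Int.eq_ofNat_of_zero_le (show 0 ≤ v2 - (t2 + g2) by omega)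
    have hk : (i, j) ∈ Finset.range (2 * N + 1) ×ˢ Finset.range (2 * N + 1) := by
      simp only [Finset.mem_product, Finset.mem_range]
      omega
    have hpP : ((p (i, j) : ℕ) : ℤ) ∣ P := Int.natCast_dvd_natCast.2 (Finset.dvd_prod_of_mem p hk)
    have d1 : ((p (i, j) : ℕ) : ℤ) ∣ v1 := by
      have := dvd_add (Int.natCast_dvd_natCast.2 (h1 _ hk)) (hpP.trans hg1)
      have e : v1 = ((t1 + i : ℕ) : ℤ) + g1 := by push_cast; omega
      rw [e]; exact this
    have d2 : ((p (i, j) : ℕ) : ℤ) ∣ v2 := by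
      have := dvd_add (Int.natCast_dvd_natCast.2 (h2 _ hk)) (hpP.trans hg2)
      have e : v2 = ((t2 + j : ℕ) : ℤ) + g2 := by push_cast; omega
      rw [e]; exact this
    have hd := Int.dvd_coe_gcd d1 d2
    have hv' : Int.gcd v1 v2 = 1 := hv
    rw [hv'] at hd
    exact (hp (i, j)).one_lt.ne' (Nat.dvd_one.1 (Int.natCast_dvd_natCast.1 hd))

/-- For every radius `ρ > 0` there are a finite-index subgroup `Γ` of `ℤ²` and a point
`t ∈ ℤ²` such that every ball of radius `ρ` centred at a point of `t + Γ` contains no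
visible point.  In particular, `V` is not relatively dense in `ℝ²`. -/
theorem visible_holes :
    (∀ ρ : ℝ, 0 < ρ → ∃ (Γ : AddSubgroup (ℤ × ℤ)) (t : ℤ × ℤ), Γ.FiniteIndex ∧
      ∀ g ∈ Γ, ∀ v ∈ Vis,
        ¬ (((v.1 : ℝ) - ((t.1 : ℝ) + (g.1 : ℝ)))^2 +
           ((v.2 : ℝ) - ((t.2 : ℝ) + (g.2 : ℝ)))^2 < ρ^2)) ∧
    ¬ ∃ r : ℝ, ∀ x : ℝ × ℝ, ∃ v ∈ Vis,
        ((v.1 : ℝ) - x.1)^2 + ((v.2 : ℝ) - x.2)^2 < r^2 := by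
  refine ⟨holes_aux, ?_⟩
  rintro ⟨r, hr⟩
  obtain ⟨Γ, t, -, h⟩ := holes_aux (|r| + 1) (by positivity)
  obtain ⟨v, hv, hlt⟩ := hr ((t.1 : ℝ), (t.2 : ℝ))
  refine h 0 Γ.zero_mem v hv ?_
  have h1 : r ^ 2 < (|r| + 1) ^ 2 := by
    nlinarith [sq_abs r, abs_nonneg r]
  simp only [Prod.fst_zero, Prod.snd_zero, Int.cast_zero, add_zero]
  exact hlt.trans h1
end

section
/- The difference set of the visible points is the whole lattice: V − V = ℤ², i.e. every x ∈ ℤ² can be written as x = v − w with v, w ∈ V. -/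
/-- The difference set of the visible points is the whole lattice: `V − V = ℤ²`. -/
theorem visible_difference_set :
    {x : ℤ × ℤ | ∃ v ∈ Vis, ∃ w ∈ Vis, x = v - w} = Set.univ := by
  rw [Set.eq_univ_iff_forall]
  rintro ⟨a, b⟩
  -- it suffices to find `(p, q)` unimodular with the direction of `(a, b)`
  have key : ∃ p q a' b' : ℤ, p * b' - q * a' = 1 ∧ a * b' = b * a' := by
    by_cases h : Int.gcd a b = 0
    · rw [Int.gcd_eq_zero_iff] at h
      exact ⟨1, 0, 0, 1, by simp, by simp [h.1]⟩
    · obtain ⟨a', ha⟩ := Int.gcd_dvd_left a b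
      obtain ⟨b', hb⟩ := Int.gcd_dvd_right a b
      have hbez := Int.gcd_eq_gcd_ab a b
      have hg : (Int.gcd a b : ℤ) ≠ 0 := by exact_mod_cast h
      generalize (Int.gcd a b : ℤ) = g at *
      refine ⟨Int.gcdB a b, -Int.gcdA a b, a', b', ?_, ?_⟩
      · apply mul_left_cancel₀ hg
        linear_combination -hbez - Int.gcdA a b * ha - Int.gcdB a b * hb
      · linear_combination b' * ha - a' * hb
  obtain ⟨p, q, a', b', h1, h2⟩ := key
  refine ⟨(p + a, q + b), ?_, (p, q), ?_, by simp⟩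
  · change Int.gcd (p + a) (q + b) = 1
    rw [← Int.isCoprime_iff_gcd_eq_one]
    exact ⟨b', -a', by linear_combination h1 + h2⟩
  · change Int.gcd p q = 1
    rw [← Int.isCoprime_iff_gcd_eq_one]
    exact ⟨b', -a', by linear_combination h1⟩
end

section
/- The natural density of the visible points exists and equals 1/ζ(2) = 6/π², i.e. lim_{R→∞} |V ∩ B_R(0)|/(π R²) = 6/π². -/
open Filter Topology

open scoped Pointwise

/-- Finite set of nonzero lattice points in the open disc of radius `R`. -/
noncomputable def discPts (R : ℝ) : Finset (ℤ × ℤ) := by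
  classical
  exact (Finset.Icc (-⌊R⌋) ⌊R⌋ ×ˢ Finset.Icc (-⌊R⌋) ⌊R⌋).filter
    (fun x => x ≠ 0 ∧ (x.1 : ℝ)^2 + (x.2 : ℝ)^2 < R^2)

lemma int_mem_Icc_floor {R : ℝ} (hR : 0 ≤ R) {a : ℤ} (h : (a : ℝ)^2 < R^2) :
    a ∈ Finset.Icc (-⌊R⌋) ⌊R⌋ := by
  have h1 := abs_lt_of_sq_lt_sq' h hR
  rw [Finset.mem_Icc]
  constructor
  · have : -a ≤ ⌊R⌋ := Int.le_floor.mpr (by push_cast; linarith [h1.1])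
    linarith
  · exact Int.le_floor.mpr h1.2.le

lemma mem_discPts {R : ℝ} (hR : 0 ≤ R) (x : ℤ × ℤ) :
    x ∈ discPts R ↔ x ≠ 0 ∧ (x.1 : ℝ)^2 + (x.2 : ℝ)^2 < R^2 := by
  classical
  simp only [discPts, Finset.mem_filter, Finset.mem_product]
  constructor
  · exact fun h => h.2
  · intro h
    refine ⟨⟨int_mem_Icc_floor hR ?_, int_mem_Icc_floor hR ?_⟩, h⟩
    · nlinarith [h.2, sq_nonneg (x.2 : ℝ)]
    · nlinarith [h.2, sq_nonneg (x.1 : ℝ)]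

lemma one_le_of_ne_zero {x : ℤ × ℤ} (hx : x ≠ 0) : (1 : ℝ) ≤ (x.1 : ℝ)^2 + (x.2 : ℝ)^2 := by
  have : (1 : ℤ) ≤ x.1^2 + x.2^2 := by
    by_contra! h
    apply hx
    have h1 : x.1 = 0 := by nlinarith [sq_nonneg x.1, sq_nonneg x.2]
    have h2 : x.2 = 0 := by nlinarith [sq_nonneg x.1, sq_nonneg x.2]
    exact Prod.ext h1 h2
  exact_mod_cast this

lemma card_discPts_of_le_one {R : ℝ} (hR : 0 ≤ R) (hR1 : R ≤ 1) : (discPts R).card = 0 := by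
  rw [Finset.card_eq_zero, Finset.eq_empty_iff_forall_notMem]
  intro x hx
  rw [mem_discPts hR] at hx
  nlinarith [one_le_of_ne_zero hx.1, hx.2]

lemma card_discPts_le {R : ℝ} (hR : 0 ≤ R) : ((discPts R).card : ℝ) ≤ 9 * R^2 := by
  classical
  rcases le_or_gt R 1 with h | h
  · rw [card_discPts_of_le_one hR h]; simp; positivity
  · have h1 : (discPts R).card ≤ (2 * ⌊R⌋ + 1).toNat * (2 * ⌊R⌋ + 1).toNat := by
      refine (Finset.card_filter_le _ _).trans ?_
      rw [Finset.card_product, Int.card_Icc]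
      apply le_of_eq
      congr 2 <;> ring
    have h0 : 0 ≤ ⌊R⌋ := Int.floor_nonneg.mpr hR
    have h2 : (((2 * ⌊R⌋ + 1).toNat : ℕ) : ℝ) = 2 * (⌊R⌋ : ℝ) + 1 := by
      have : (((2 * ⌊R⌋ + 1).toNat : ℕ) : ℤ) = 2 * ⌊R⌋ + 1 := Int.toNat_of_nonneg (by linarith)
      exact_mod_cast this
    have h3 : ((discPts R).card : ℝ) ≤ (2 * (⌊R⌋ : ℝ) + 1) * (2 * (⌊R⌋ : ℝ) + 1) := by
      rw [← h2]; exact_mod_cast h1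
    have h4 := Int.floor_le R
    have h5 : (0 : ℝ) ≤ (⌊R⌋ : ℝ) := by exact_mod_cast h0
    have h6 : 2 * (⌊R⌋ : ℝ) + 1 ≤ 3 * R := by linarith
    nlinarith [mul_self_le_mul_self (by linarith : 0 ≤ 2 * (⌊R⌋ : ℝ) + 1) h6]

/-- Unit disc in `Fin 2 → ℝ`. -/
def uDisc : Set (Fin 2 → ℝ) := {v | v 0 ^ 2 + v 1 ^ 2 < 1}

lemma uDisc_eq : uDisc = (WithLp.toLp 2) ⁻¹' (Metric.ball (0 : EuclideanSpace ℝ (Fin 2)) 1) := by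
  ext v
  simp only [uDisc, Set.mem_ofPred_eq, Set.mem_preimage, mem_ball_zero_iff, EuclideanSpace.norm_eq,
    Fin.sum_univ_two, Real.norm_eq_abs, sq_abs]
  rw [Real.sqrt_lt' one_pos]
  simp

lemma uDisc_convex : Convex ℝ uDisc := by
  rw [uDisc_eq]
  exact (convex_ball (0 : EuclideanSpace ℝ (Fin 2)) 1).linear_preimage
    ((WithLp.linearEquiv 2 ℝ (Fin 2 → ℝ)).symm.toLinearMap)

lemma uDisc_volume : MeasureTheory.volume.real uDisc = Real.pi := by
  rw [uDisc_eq, MeasureTheory.Measure.real, (PiLp.volume_preserving_toLp (Fin 2)).measure_preimage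
    measurableSet_ball.nullMeasurableSet]
  simp [Real.pi_pos.le]

lemma uDisc_open : IsOpen uDisc :=
  isOpen_lt (by fun_prop) (by fun_prop)

lemma uDisc_bounded : Bornology.IsBounded uDisc := by
  refine (Metric.isBounded_ball (x := (0 : Fin 2 → ℝ)) (r := 2)).subset ?_
  intro v hv
  simp only [uDisc, Set.mem_ofPred_eq] at hv
  rw [mem_ball_zero_iff, pi_norm_lt_iff (by norm_num)]
  intro i
  rw [Real.norm_eq_abs]
  apply abs_lt_of_sq_lt_sq _ (by norm_num)
  fin_cases i <;> simp <;> nlinarith [sq_nonneg (v 0), sq_nonneg (v 1)]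

lemma uDisc_mono ⦃x y : ℝ⦄ (hx : 0 < x) (hxy : x ≤ y) : x • uDisc ⊆ y • uDisc := by
  have hy : 0 < y := hx.trans_le hxy
  intro v hv
  rw [Set.mem_smul_set_iff_inv_smul_mem₀ hx.ne'] at hv
  rw [Set.mem_smul_set_iff_inv_smul_mem₀ hy.ne']
  simp only [uDisc, Set.mem_ofPred_eq, Pi.smul_apply, smul_eq_mul, mul_pow] at hv ⊢
  have h : y⁻¹ ^ 2 ≤ x⁻¹ ^ 2 := by gcongr
  nlinarith [sq_nonneg (v 0), sq_nonneg (v 1)]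

lemma mem_smul_span_real {x : ℝ} (hx : x ≠ 0) {v : Fin 2 → ℝ} :
    v ∈ x⁻¹ • Submodule.span ℤ (Set.range (Pi.basisFun ℝ (Fin 2))) ↔
      ∀ i, x * v i ∈ Set.range (algebraMap ℤ ℝ) := by
  rw [ZSpan.smul _ (inv_ne_zero hx), Module.Basis.mem_span_iff_repr_mem]
  simp_rw [Module.Basis.repr_isUnitSMul, Pi.basisFun_repr, Units.smul_def, Units.val_inv_eq_inv_val,
    IsUnit.unit_spec, inv_inv, smul_eq_mul]

lemma card_uDisc {x : ℝ} (hx : 0 < x) :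
    Nat.card ↑(uDisc ∩ x⁻¹ • (Submodule.span ℤ (Set.range (Pi.basisFun ℝ (Fin 2))) :
      Set (Fin 2 → ℝ))) = (discPts x).card + 1 := by
  classical
  have h0 : (0 : ℤ × ℤ) ∉ discPts x := by simp [mem_discPts hx.le]
  rw [← Finset.card_insert_of_notMem h0, ← Nat.card_eq_finsetCard]
  symm
  have hmem : ∀ p : ℤ × ℤ, p ∈ insert 0 (discPts x) ↔ (p.1 : ℝ)^2 + (p.2 : ℝ)^2 < x^2 := by
    intro p
    rw [Finset.mem_insert, mem_discPts hx.le]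
    by_cases hp : p = 0
    · subst hp
      simpa using pow_pos hx 2
    · simp [hp]
  refine Nat.card_eq_of_bijective (fun p => ⟨![x⁻¹ * (p.1.1 : ℝ), x⁻¹ * (p.1.2 : ℝ)], ?_, ?_⟩)
    ⟨?_, ?_⟩
  · have h := (hmem p.1).mp p.2
    simp only [uDisc, Set.mem_ofPred_eq, Matrix.cons_val_zero, Matrix.cons_val_one]
    rw [mul_pow, mul_pow, ← mul_add, inv_pow, inv_mul_lt_iff₀ (by positivity), mul_one]
    exact h
  · rw [← Submodule.coe_pointwise_smul, SetLike.mem_coe, mem_smul_span_real hx.ne']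
    intro i
    fin_cases i
    · exact ⟨p.1.1, by simp [hx.ne']⟩
    · exact ⟨p.1.2, by simp [hx.ne']⟩
  · rintro ⟨⟨a, b⟩, hp⟩ ⟨⟨c, d⟩, hq⟩ h
    have h' := congrArg Subtype.val h
    have e0 := congrFun h' 0
    have e1 := congrFun h' 1
    simp [hx.ne'] at e0 e1
    subst e0 e1
    rfl
  · rintro ⟨v, hv, hv'⟩
    rw [← Submodule.coe_pointwise_smul, SetLike.mem_coe, mem_smul_span_real hx.ne'] at hv'
    obtain ⟨a, ha⟩ := hv' 0
    obtain ⟨b, hb⟩ := hv' 1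
    simp only [algebraMap_int_eq, eq_intCast] at ha hb
    refine ⟨⟨(a, b), ?_⟩, ?_⟩
    · rw [hmem]
      simp only [uDisc, Set.mem_ofPred_eq] at hv
      simp only [ha, hb]
      have : 0 < x^2 := by positivity
      nlinarith
    · apply Subtype.ext
      funext i
      fin_cases i
      · simp [ha, hx.ne']
      · simp [hb, hx.ne']

lemma tendsto_discPts :
    Tendsto (fun R : ℝ => ((discPts R).card : ℝ) / R^2) atTop (𝓝 Real.pi) := by
  have h := tendsto_card_div_pow_atTop_volume' uDisc uDisc_bounded uDisc_open.measurableSet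
    (uDisc_convex.addHaar_frontier _) uDisc_mono
  rw [uDisc_volume] at h
  have h2 : Tendsto (fun R : ℝ => 1 / R^2) atTop (𝓝 0) := by
    simp only [one_div]
    exact (tendsto_pow_atTop (α := ℝ) (n := 2) two_ne_zero).inv_tendsto_atTop
  have h3 := h.sub h2
  rw [sub_zero] at h3
  refine h3.congr' ?_
  filter_upwards [eventually_gt_atTop 0] with x hx
  rw [card_uDisc hx]
  simp
  ring

lemma sum_moebius_divisors {n : ℕ} (hn : n ≠ 0) :
    ∑ d ∈ n.divisors, ArithmeticFunction.moebius d = if n = 1 then 1 else 0 := by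
  rw [← ArithmeticFunction.coe_mul_zeta_apply, ArithmeticFunction.moebius_mul_coe_zeta,
    ArithmeticFunction.one_apply]

lemma gcd_le_of_mem {R : ℝ} (hR : 0 ≤ R) {x : ℤ × ℤ} (hx : x ∈ discPts R) :
    ((Int.gcd x.1 x.2 : ℕ) : ℝ) < R := by
  rw [mem_discPts hR] at hx
  apply lt_of_pow_lt_pow_left₀ 2 hR
  refine lt_of_le_of_lt ?_ hx.2
  obtain ⟨a, ha⟩ := Int.gcd_dvd_left x.1 x.2
  obtain ⟨b, hb⟩ := Int.gcd_dvd_right x.1 x.2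
  have hab : ((a, b) : ℤ × ℤ) ≠ 0 := by
    rintro h
    simp only [Prod.mk_eq_zero] at h
    rw [h.1, mul_zero] at ha
    rw [h.2, mul_zero] at hb
    exact hx.1 (Prod.ext ha hb)
  have h1 := one_le_of_ne_zero hab
  have ha' : (x.1 : ℝ) = (Int.gcd x.1 x.2 : ℕ) * (a : ℝ) := by exact_mod_cast ha
  have hb' : (x.2 : ℝ) = (Int.gcd x.1 x.2 : ℕ) * (b : ℝ) := by exact_mod_cast hb
  generalize ((Int.gcd x.1 x.2 : ℕ) : ℝ) = g at *
  rw [ha', hb']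
  simp only at h1
  nlinarith [sq_nonneg g]

lemma card_dvd {R : ℝ} (hR : 0 < R) {d : ℕ} (hd : 0 < d) :
    ((discPts R).filter (fun x => d ∣ Int.gcd x.1 x.2)).card = (discPts (R / d)).card := by
  classical
  have hd' : (0 : ℝ) < d := by exact_mod_cast hd
  have hdz : (d : ℤ) ≠ 0 := by exact_mod_cast hd.ne'
  have key : ∀ x : ℤ × ℤ, ((d : ℤ) * x.1, (d : ℤ) * x.2) ∈ discPts R ↔ x ∈ discPts (R / d) := by
    intro x
    rw [mem_discPts hR.le, mem_discPts (by positivity)]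
    apply and_congr
    · simp [Prod.ext_iff, hd.ne']
    · rw [div_pow, lt_div_iff₀ (by positivity)]
      push_cast
      ring_nf
  symm
  refine Finset.card_bij (fun x _ => ((d : ℤ) * x.1, (d : ℤ) * x.2)) ?_ ?_ ?_
  · intro x hx
    rw [Finset.mem_filter, key]
    refine ⟨hx, ?_⟩
    exact Int.dvd_gcd (Dvd.intro _ rfl) (Dvd.intro _ rfl)
  · intro x _ y _ h
    simp only [Prod.mk.injEq] at h
    exact Prod.ext (mul_left_cancel₀ hdz h.1) (mul_left_cancel₀ hdz h.2)
  · rintro ⟨a, b⟩ hx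
    rw [Finset.mem_filter] at hx
    have hz : (d : ℤ) ∣ (Int.gcd a b : ℕ) := by exact_mod_cast hx.2
    obtain ⟨a', rfl⟩ := hz.trans (Int.gcd_dvd_left a b)
    obtain ⟨b', rfl⟩ := hz.trans (Int.gcd_dvd_right _ b)
    exact ⟨(a', b'), (key (a', b')).mp hx.1, rfl⟩

lemma card_vis {R : ℝ} (hR : 0 < R) :
    (Nat.card {x : ℤ × ℤ // x ∈ Vis ∧ (x.1 : ℝ)^2 + (x.2 : ℝ)^2 < R^2} : ℝ) =
      ∑' d : ℕ, (ArithmeticFunction.moebius d : ℝ) * ((discPts (R / d)).card : ℝ) := by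
  classical
  have h1 : Nat.card {x : ℤ × ℤ // x ∈ Vis ∧ (x.1 : ℝ)^2 + (x.2 : ℝ)^2 < R^2} =
      ((discPts R).filter (fun x => Int.gcd x.1 x.2 = 1)).card := by
    rw [← Nat.card_eq_finsetCard]
    apply Nat.card_congr
    apply Equiv.subtypeEquivRight
    intro x
    rw [Finset.mem_filter, mem_discPts hR.le]
    constructor
    · rintro ⟨h, h'⟩
      refine ⟨⟨?_, h'⟩, h⟩
      rintro rfl
      simp [Vis] at h
    · rintro ⟨⟨_, h⟩, h'⟩
      exact ⟨h', h⟩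
  rw [tsum_eq_sum (s := Finset.Icc 1 ⌈R⌉₊)]
  · rw [h1]
    have h2 : ((((discPts R).filter (fun x => Int.gcd x.1 x.2 = 1)).card : ℕ) : ℤ) =
        ∑ d ∈ Finset.Icc 1 ⌈R⌉₊, ArithmeticFunction.moebius d * ((discPts (R / d)).card : ℤ) := by
      rw [Finset.card_filter]
      push_cast
      calc _ = ∑ x ∈ discPts R, ∑ d ∈ Finset.Icc 1 ⌈R⌉₊,
            if d ∣ Int.gcd x.1 x.2 then ArithmeticFunction.moebius d else 0 := by
            refine Finset.sum_congr rfl fun x hx => ?_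
            have hg : Int.gcd x.1 x.2 ≠ 0 := by
              rw [mem_discPts hR.le] at hx
              intro h
              rw [Int.gcd_eq_zero_iff] at h
              exact hx.1 (Prod.ext h.1 h.2)
            rw [← sum_moebius_divisors hg, ← Finset.sum_filter]
            refine Finset.sum_congr ?_ fun _ _ => rfl
            ext d
            simp only [Nat.mem_divisors, Finset.mem_filter, Finset.mem_Icc]
            constructor
            · rintro ⟨h, _⟩
              refine ⟨⟨Nat.pos_of_dvd_of_pos h (Nat.pos_of_ne_zero hg), ?_⟩, h⟩
              have := gcd_le_of_mem hR.le hx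
              refine (Nat.le_of_dvd (Nat.pos_of_ne_zero hg) h).trans ?_
              exact_mod_cast this.le.trans (Nat.le_ceil R)
            · exact fun h => ⟨h.2, hg⟩
        _ = _ := by
            rw [Finset.sum_comm]
            refine Finset.sum_congr rfl fun d hd => ?_
            rw [← card_dvd hR (Finset.mem_Icc.mp hd).1, ← Finset.sum_filter, Finset.sum_const,
              nsmul_eq_mul, mul_comm]
    exact_mod_cast congrArg (Int.cast : ℤ → ℝ) h2
  · intro d hd
    rcases Nat.eq_zero_or_pos d with rfl | h
    · simp
    · have hlt : ⌈R⌉₊ < d := by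
        by_contra! h'
        exact hd (Finset.mem_Icc.mpr ⟨h, h'⟩)
      have h' : R ≤ d := (Nat.le_ceil R).trans (by exact_mod_cast hlt.le)
      have hd' : (0 : ℝ) < d := by exact_mod_cast h
      rw [card_discPts_of_le_one (by positivity) ((div_le_one hd').mpr h')]
      simp

lemma tsum_moebius :
    ∑' d : ℕ, (ArithmeticFunction.moebius d : ℝ) * (1 / (d : ℝ)^2) = 6 / Real.pi^2 := by
  have h := ArithmeticFunction.LSeries_zeta_mul_Lseries_moebius (s := 2) (by norm_num)
  rw [ArithmeticFunction.LSeries_zeta_eq_riemannZeta (by norm_num), riemannZeta_two] at h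
  have h2 : LSeries (fun n => ((ArithmeticFunction.moebius n : ℤ) : ℂ)) 2 =
      ((∑' d : ℕ, (ArithmeticFunction.moebius d : ℝ) * (1 / (d : ℝ)^2) : ℝ) : ℂ) := by
    rw [LSeries, Complex.ofReal_tsum]
    refine tsum_congr fun d => ?_
    rw [LSeries.term_def]
    split_ifs with hd
    · simp [hd]
    · push_cast
      rw [show (2 : ℂ) = ((2 : ℕ) : ℂ) by norm_num, Complex.cpow_natCast]
      ring
  rw [h2] at h
  have h3 : Real.pi^2 / 6 *
      (∑' d : ℕ, (ArithmeticFunction.moebius d : ℝ) * (1 / (d : ℝ)^2)) = 1 := by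
    exact_mod_cast h
  have hpi := Real.pi_pos
  field_simp
  field_simp at h3
  linarith

/-- The natural density of the visible points exists and equals `1/ζ(2) = 6/π²`. -/
theorem visible_density :
    Tendsto (fun R : ℝ =>
      (Nat.card {x : ℤ × ℤ // x ∈ Vis ∧ (x.1 : ℝ)^2 + (x.2 : ℝ)^2 < R^2} : ℝ) /
        (Real.pi * R^2))
      atTop (𝓝 (6 / Real.pi^2)) := by
  have hpi := Real.pi_pos
  have key : Tendsto (fun R : ℝ => ∑' d : ℕ, (ArithmeticFunction.moebius d : ℝ) *
      (((discPts (R / d)).card : ℝ) / (Real.pi * R^2))) atTop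
      (𝓝 (∑' d : ℕ, (ArithmeticFunction.moebius d : ℝ) * (1 / (d : ℝ)^2))) := by
    refine tendsto_tsum_of_dominated_convergence
      (bound := fun d : ℕ => 9 / Real.pi * (1 / (d : ℝ)^2)) ?_ ?_ ?_
    · exact (Real.summable_one_div_nat_pow.mpr (by norm_num)).mul_left _
    · intro d
      rcases Nat.eq_zero_or_pos d with rfl | h
      · simp
      have hd' : (0 : ℝ) < d := by exact_mod_cast h
      refine Tendsto.const_mul _ ?_
      have h1 := (tendsto_discPts.comp (tendsto_id.atTop_div_const hd')).mul_const
        (1 / (Real.pi * (d : ℝ)^2))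
      have e : Real.pi * (1 / (Real.pi * (d : ℝ)^2)) = 1 / (d : ℝ)^2 := by field_simp
      rw [e] at h1
      refine h1.congr' ?_
      filter_upwards [eventually_gt_atTop 0] with R hR
      simp only [Function.comp, id]
      field_simp
    · filter_upwards [eventually_gt_atTop 0] with R hR d
      rcases Nat.eq_zero_or_pos d with rfl | h
      · simp
      have hd' : (0 : ℝ) < d := by exact_mod_cast h
      rw [norm_mul, Real.norm_eq_abs, Real.norm_of_nonneg (by positivity)]
      have hm : |(ArithmeticFunction.moebius d : ℝ)| ≤ 1 := by
        exact_mod_cast ArithmeticFunction.abs_moebius_le_one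
      have hc := card_discPts_le (R := R / d) (by positivity)
      calc _ ≤ 1 * ((9 * (R / d)^2) / (Real.pi * R^2)) := by gcongr
        _ = _ := by field_simp
  rw [tsum_moebius] at key
  refine key.congr' ?_
  filter_upwards [eventually_gt_atTop 0] with R hR
  rw [card_vis hR, ← tsum_div_const]
  simp only [mul_div_assoc]
end

section
/- For each x ∈ ℤ², the natural autocorrelation coefficient η(x) = lim_{R→∞} (1/(π R²)) |V ∩ (−x + V) ∩ B_R(0)| exists. For x = 0 one has η(0) = ∏_p (1 − p⁻²) = 1/ζ(2), and for x ≠ 0 one has η(x) = ξ · ∏_{p | gcd(x₁,x₂)} (1 + 1/(p² − 2)), where ξ = ∏_p (1 − 2p⁻²) (the unrestricted products running over all primes p, the restricted product over the finitely many primes dividing gcd(x₁,x₂)). -/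
open Filter Topology

def BN (S : Set (ℤ × ℤ)) (R : ℝ) : Set (ℤ × ℤ) :=
  {v | v ∈ S ∧ (v.1 : ℝ)^2 + (v.2 : ℝ)^2 < R^2}

noncomputable def dens (S : Set (ℤ × ℤ)) (R : ℝ) : ℝ := ((BN S R).ncard : ℝ) / (Real.pi * R^2)

def HasDens (S : Set (ℤ × ℤ)) (d : ℝ) : Prop := Tendsto (dens S) atTop (𝓝 d)

lemma BN_subset (S : Set (ℤ × ℤ)) (R : ℝ) :
    BN S R ⊆ (Finset.Icc (-⌊|R|⌋) ⌊|R|⌋ ×ˢ Finset.Icc (-⌊|R|⌋) ⌊|R|⌋ : Finset (ℤ × ℤ)) := by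
  rintro ⟨a, b⟩ ⟨-, h⟩
  simp only at h
  have key : ∀ u : ℤ, (u:ℝ)^2 < R^2 → -⌊|R|⌋ ≤ u ∧ u ≤ ⌊|R|⌋ := by
    intro u hu
    have := sq_lt_sq.1 hu
    have h2 : |u| ≤ ⌊|R|⌋ := by
      rw [Int.le_floor]; push_cast; exact this.le
    exact abs_le.1 h2
  have ha := key a (by nlinarith [sq_nonneg (b:ℝ)])
  have hb := key b (by nlinarith [sq_nonneg (a:ℝ)])
  simp [ha, hb]

lemma BN_finite (S : Set (ℤ × ℤ)) (R : ℝ) : (BN S R).Finite :=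
  (Finset.finite_toSet _).subset (BN_subset S R)

def disc : Set (Fin 2 → ℝ) := {v | v 0 ^ 2 + v 1 ^ 2 < 1}

lemma disc_eq : disc = (WithLp.toLp 2 : (Fin 2 → ℝ) → EuclideanSpace ℝ (Fin 2)) ⁻¹' (Metric.ball 0 1) := by
  ext v
  simp only [disc, Set.mem_ofPred_eq, Set.mem_preimage, Metric.mem_ball, dist_zero_right,
    EuclideanSpace.norm_eq, Fin.sum_univ_two, Real.norm_eq_abs, sq_abs]
  rw [Real.sqrt_lt' one_pos]; simp

lemma disc_open : IsOpen disc := by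
  unfold disc
  exact isOpen_lt (by fun_prop) (by fun_prop)

lemma disc_vol : MeasureTheory.volume.real disc = Real.pi := by
  rw [MeasureTheory.measureReal_def, disc_eq,
    (PiLp.volume_preserving_toLp (Fin 2)).measure_preimage Metric.isOpen_ball.measurableSet.nullMeasurableSet,
    EuclideanSpace.volume_ball_fin_two]
  simp [Real.pi_pos.le]

lemma disc_convex : Convex ℝ disc := by
  rw [disc_eq]
  exact (convex_ball (0 : EuclideanSpace ℝ (Fin 2)) 1).linear_preimage
    (WithLp.linearEquiv 2 ℝ (Fin 2 → ℝ)).symm.toLinearMap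

lemma disc_bdd : Bornology.IsBounded disc := by
  refine (Metric.isBounded_closedBall (x := (0 : Fin 2 → ℝ)) (r := 1)).subset ?_
  intro v hv
  simp only [disc, Set.mem_ofPred_eq] at hv
  rw [mem_closedBall_zero_iff, pi_norm_le_iff_of_nonneg zero_le_one]
  intro i
  rw [Real.norm_eq_abs, ← sq_le_one_iff_abs_le_one]
  fin_cases i
  · change v 0 ^ 2 ≤ 1
    nlinarith [sq_nonneg (v 0), sq_nonneg (v 1)]
  · change v 1 ^ 2 ≤ 1
    nlinarith [sq_nonneg (v 0), sq_nonneg (v 1)]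

open Pointwise in
lemma hasDens_univ : HasDens Set.univ 1 := by
  have h := tendsto_card_div_pow_atTop_volume' disc disc_bdd disc_open.measurableSet
    (disc_convex.addHaar_frontier MeasureTheory.volume) (by
      intro x y hx hxy
      rintro _ ⟨v, hv, rfl⟩
      have hy : 0 < y := hx.trans_le hxy
      refine ⟨(x / y) • v, ?_, ?_⟩
      · simp only [disc, Set.mem_ofPred_eq, Pi.smul_apply, smul_eq_mul] at hv ⊢
        have h1 : x / y ≤ 1 := (div_le_one hy).2 hxy
        have h0 : 0 ≤ x / y := by positivity
        have : (x/y)^2 ≤ 1 := by nlinarith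
        nlinarith [sq_nonneg (v 0), sq_nonneg (v 1)]
      · simp only [smul_smul]; congr 1; field_simp)
  rw [disc_vol] at h
  have h2 := h.div_const Real.pi
  rw [div_self Real.pi_ne_zero] at h2
  refine h2.congr' ?_
  filter_upwards [eventually_gt_atTop 0] with R hR
  have key : (disc ∩ R⁻¹ • (Submodule.span ℤ (Set.range (Pi.basisFun ℝ (Fin 2))) : Set (Fin 2 → ℝ)))
      = (fun v : ℤ × ℤ => (![R⁻¹ * v.1, R⁻¹ * v.2] : Fin 2 → ℝ)) '' BN Set.univ R := by
    have e : ∀ a b : ℝ, ((R⁻¹ * a)^2 + (R⁻¹ * b)^2 < 1 ↔ a^2+b^2 < R^2) := by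
      intro a b
      rw [show (R⁻¹ * a)^2 + (R⁻¹ * b)^2 = (a^2+b^2)/R^2 by field_simp, div_lt_one (by positivity)]
    ext w
    constructor
    · rintro ⟨hw, u, hu, rfl⟩
      rw [SetLike.mem_coe, Module.Basis.mem_span_iff_repr_mem] at hu
      obtain ⟨a, ha⟩ := hu 0
      obtain ⟨b, hb⟩ := hu 1
      simp at ha hb
      simp only [disc, Set.mem_ofPred_eq, Pi.smul_apply, smul_eq_mul, e] at hw
      refine ⟨(a, b), ⟨trivial, ?_⟩, ?_⟩
      · simpa [ha, hb] using hw
      · ext i; fin_cases i <;> simp [ha, hb]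
    · rintro ⟨⟨a, b⟩, ⟨-, hab⟩, rfl⟩
      refine ⟨?_, ![(a:ℝ), b], ?_, ?_⟩
      · simp only [disc, Set.mem_ofPred_eq]
        simpa [e] using hab
      · rw [SetLike.mem_coe, Module.Basis.mem_span_iff_repr_mem]
        intro i; fin_cases i <;> simp
      · ext i; fin_cases i <;> simp
  rw [key, Nat.card_coe_set_eq, Set.ncard_image_of_injective]
  · simp only [dens, Fintype.card_fin]; rw [div_div, mul_comm]
  · rintro ⟨a, b⟩ ⟨c, d⟩ h
    have h0 := congrFun h 0
    have h1 := congrFun h 1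
    simp [hR.ne'] at h0 h1
    simp [h0, h1]

lemma tri {u1 u2 R : ℝ} (a1 a2 : ℝ) (hR : 0 < R) (h : u1^2+u2^2 < R^2) :
    (u1+a1)^2+(u2+a2)^2 < (R+(|a1|+|a2|))^2 := by
  have h1 : |u1| < R := by apply abs_lt_of_sq_lt_sq _ hR.le; nlinarith [sq_nonneg u2]
  have h2 : |u2| < R := by apply abs_lt_of_sq_lt_sq _ hR.le; nlinarith [sq_nonneg u1]
  have e1 : u1*a1 ≤ R*|a1| := (le_abs_self _).trans (by rw [abs_mul]; gcongr)
  have e2 : u2*a2 ≤ R*|a2| := (le_abs_self _).trans (by rw [abs_mul]; gcongr)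
  nlinarith [sq_abs a1, sq_abs a2, mul_nonneg (abs_nonneg a1) (abs_nonneg a2)]

def Cos (M : ℤ) (a : ℤ × ℤ) : Set (ℤ × ℤ) := {v | M ∣ v.1 - a.1 ∧ M ∣ v.2 - a.2}

lemma scaled (M c : ℝ) (hM : 0 < M) :
    Tendsto (fun R : ℝ => ((BN Set.univ ((R+c)/M)).ncard : ℝ) / (Real.pi * R^2)) atTop (𝓝 (1/M^2)) := by
  have h1 : Tendsto (fun R : ℝ => (R+c)/M) atTop atTop :=
    (tendsto_atTop_add_const_right _ c tendsto_id).atTop_div_const hM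
  have h2 := hasDens_univ.comp h1
  have h3 : Tendsto (fun R : ℝ => (1 + c / R) / M) atTop (𝓝 ((1+0)/M)) :=
    (tendsto_const_nhds.add (tendsto_const_nhds.div_atTop tendsto_id)).div_const M
  have h4 := h2.mul (h3.pow 2)
  rw [show 1 * ((1+0)/M)^2 = 1/M^2 by field_simp; ring] at h4
  refine h4.congr' ?_
  filter_upwards [eventually_gt_atTop 0, eventually_gt_atTop (-c)] with R hR hc
  have : R + c ≠ 0 := by linarith
  simp only [Function.comp, dens]
  field_simp

lemma hasDens_cos (M : ℤ) (hM : 0 < M) (a : ℤ × ℤ) : HasDens (Cos M a) (1/(M:ℝ)^2) := by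
  have hM' : (0:ℝ) < M := by exact_mod_cast hM
  set A : ℝ := |(a.1:ℝ)| + |(a.2:ℝ)| with hA
  have hA0 : 0 ≤ A := by positivity
  have hinj : Function.Injective (fun w : ℤ × ℤ => (a.1 + M * w.1, a.2 + M * w.2)) := by
    rintro ⟨p, q⟩ ⟨r, s⟩ h
    simpa [hM.ne'] using h
  refine tendsto_of_tendsto_of_tendsto_of_le_of_le' (scaled M (-A) hM') (scaled M A hM') ?_ ?_
  · filter_upwards [eventually_gt_atTop A] with R hR
    have hR0 : 0 < R := by linarith
    unfold dens
    refine div_le_div_of_nonneg_right (Nat.cast_le.2 ?_) (by positivity)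
    rw [← Set.ncard_image_of_injective _ hinj]
    refine Set.ncard_le_ncard ?_ (BN_finite _ _)
    rintro _ ⟨⟨p, q⟩, ⟨-, h⟩, rfl⟩
    refine ⟨⟨by simp, by simp⟩, ?_⟩
    simp only at h ⊢
    have h' : ((M:ℝ)*p)^2 + (M*q)^2 < (R + -A)^2 := by
      rw [div_pow, lt_div_iff₀ (by positivity)] at h
      nlinarith
    have := tri (a.1:ℝ) (a.2:ℝ) (by linarith) h'
    rw [← hA] at this
    push_cast
    calc _ = _ := by ring
      _ < _ := this
      _ = _ := by ring
  · filter_upwards [eventually_gt_atTop 0] with R hR0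
    unfold dens
    refine div_le_div_of_nonneg_right (Nat.cast_le.2 ?_) (by positivity)
    rw [← Set.ncard_image_of_injective (BN Set.univ ((R + A) / M)) hinj]
    refine Set.ncard_le_ncard ?_ ((BN_finite _ _).image _)
    rintro ⟨v1, v2⟩ ⟨⟨⟨p, hp⟩, ⟨q, hq⟩⟩, h⟩
    simp only at hp hq h
    refine ⟨(p, q), ⟨trivial, ?_⟩, ?_⟩
    · have := tri (-a.1:ℝ) (-a.2:ℝ) hR0 h
      rw [abs_neg, abs_neg, ← hA] at this
      have ep : (v1:ℝ) + -a.1 = M * p := by exact_mod_cast (by linarith : v1 + -a.1 = M * p)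
      have eq : (v2:ℝ) + -a.2 = M * q := by exact_mod_cast (by linarith : v2 + -a.2 = M * q)
      rw [ep, eq] at this
      simp only
      rw [div_pow, lt_div_iff₀ (by positivity)]
      nlinarith
    · simp only [Prod.mk.injEq]; constructor <;> linarith

lemma BN_diff (S T : Set (ℤ × ℤ)) (R : ℝ) : BN (S \ T) R = BN S R \ BN T R := by
  ext v; simp only [BN, Set.mem_sdiff, Set.mem_ofPred_eq]; tauto

lemma HasDens.diff {S T : Set (ℤ × ℤ)} {d e : ℝ} (hS : HasDens S d) (hT : HasDens T e)
    (h : T ⊆ S) : HasDens (S \ T) (d - e) := by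
  refine (Tendsto.sub hS hT).congr ?_
  intro R
  have hsub : BN T R ⊆ BN S R := fun v hv => ⟨h hv.1, hv.2⟩
  simp only [dens]
  rw [BN_diff, ← Set.ncard_sdiff_add_ncard_of_subset hsub (BN_finite _ _)]
  push_cast; ring

def Dv (p : ℕ) (v : ℤ × ℤ) : Prop := (p:ℤ) ∣ v.1 ∧ (p:ℤ) ∣ v.2

def Gd (x : ℤ × ℤ) (s : Set Nat.Primes) : Set (ℤ × ℤ) :=
  {v | ∀ p ∈ s, ¬ Dv p v ∧ ¬ Dv p (v + x)}

open Classical in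
noncomputable def cc (x : ℤ × ℤ) (p : ℕ) : ℝ := if Dv p x then 1 else 2

lemma crt (M q : ℤ) (h : IsCoprime M q) (a c : ℤ × ℤ) :
    ∃ b, Cos M a ∩ Cos q c = Cos (M * q) b := by
  obtain ⟨u, w, huw⟩ := h
  have key : ∀ a c v : ℤ, (M ∣ v - a ∧ q ∣ v - c) ↔ M * q ∣ v - (a * (w*q) + c * (u*M)) := by
    intro a c v
    have e1 : v - a = (v - (a * (w*q) + c * (u*M))) + M * (u * (c - a)) := by
      linear_combination a * huw
    have e2 : v - c = (v - (a * (w*q) + c * (u*M))) + q * (w * (a - c)) := by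
      linear_combination c * huw
    rw [e1, e2, dvd_add_left (dvd_mul_right _ _), dvd_add_left (dvd_mul_right _ _)]
    constructor
    · rintro ⟨h1, h2⟩
      exact IsCoprime.mul_dvd ⟨u, w, huw⟩ h1 h2
    · intro h
      exact ⟨(dvd_mul_right _ _).trans h, (dvd_mul_left _ _).trans h⟩
  refine ⟨(a.1 * (w*q) + c.1 * (u*M), a.2 * (w*q) + c.2 * (u*M)), ?_⟩
  ext v
  simp only [Cos, Set.mem_inter_iff, Set.mem_ofPred_eq, ← key]
  tauto

lemma hasDens_Gd (x : ℤ × ℤ) (s : Finset Nat.Primes) :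
    ∀ (M : ℤ) (a : ℤ × ℤ), 0 < M → (∀ p ∈ s, IsCoprime M ((p:ℕ):ℤ)) →
      HasDens (Cos M a ∩ Gd x s) (1/(M:ℝ)^2 * ∏ p ∈ s, (1 - cc x p / ((p:ℕ):ℝ)^2)) := by
  classical
  induction s using Finset.induction_on with
  | empty =>
    intro M a hM _
    simpa [Gd] using hasDens_cos M hM a
  | insert q s hq ih =>
    intro M a hM hcop
    have hqpos : 0 < ((q:ℕ):ℤ) := by exact_mod_cast q.2.pos
    have hcs : ∀ p ∈ s, IsCoprime M ((p:ℕ):ℤ) := fun p hp => hcop p (Finset.mem_insert_of_mem hp)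
    have hMq := hcop q (Finset.mem_insert_self _ _)
    have h0 := ih M a hM hcs
    have hsub : ∀ c : ℤ × ℤ, HasDens (Cos M a ∩ Gd x s ∩ Cos ((q:ℕ):ℤ) c)
        (1/(M:ℝ)^2 * (1/((q:ℕ):ℝ)^2) * ∏ p ∈ s, (1 - cc x p / ((p:ℕ):ℝ)^2)) := by
      intro c
      obtain ⟨b, hb⟩ := crt M ((q:ℕ):ℤ) hMq a c
      have := ih (M * ((q:ℕ):ℤ)) b (by positivity) (by
        intro p hp
        refine IsCoprime.mul_left (hcs p hp) ?_
        rw [Nat.isCoprime_iff_coprime, Nat.coprime_primes q.2 p.2]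
        intro h
        exact hq (by rwa [Subtype.ext h]))
      rw [← hb] at this
      convert! this using 1
      · ext v; simp only [Set.mem_inter_iff]; tauto
      · push_cast; field_simp
    have hq0 := hsub 0
    have hqx := hsub (-x)
    have m0 : ∀ v, v ∈ Cos ((q:ℕ):ℤ) 0 ↔ Dv q v := by intro v; simp [Cos, Dv]
    have mx : ∀ v, v ∈ Cos ((q:ℕ):ℤ) (-x) ↔ Dv q (v + x) := by intro v; simp [Cos, Dv]
    rw [Finset.prod_insert hq]
    by_cases hx : Dv q x
    · have := h0.diff hq0 Set.inter_subset_left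
      convert! this using 1
      · ext v
        have : Dv q v ↔ Dv q (v + x) := by
          unfold Dv at *
          simp only [Prod.fst_add, Prod.snd_add]
          rw [dvd_add_left hx.1, dvd_add_left hx.2]
        simp only [Set.mem_inter_iff, Set.mem_sdiff, m0, Gd, Set.mem_ofPred_eq, Finset.coe_insert,
          Set.mem_insert_iff, forall_eq_or_imp, ← this]
        tauto
      · simp only [cc, hx, if_true]; ring
    · have := (h0.diff hq0 Set.inter_subset_left).diff hqx (by
        rintro v ⟨hv, hv2⟩
        refine ⟨hv, fun h => hx ?_⟩
        have h1 := (m0 v).1 h.2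
        have h2 := (mx v).1 hv2
        unfold Dv at *
        exact ⟨(dvd_add_right h1.1).1 h2.1, (dvd_add_right h1.2).1 h2.2⟩)
      convert! this using 1
      · ext v
        simp only [Set.mem_inter_iff, Set.mem_sdiff, m0, mx, Gd, Set.mem_ofPred_eq, Finset.coe_insert,
          Set.mem_insert_iff, forall_eq_or_imp]
        tauto
      · simp only [cc, hx, if_false]; ring

lemma Ecard (s : Finset Nat.Primes) (T : ℝ)
    (hT : ∀ t : Finset Nat.Primes, Disjoint t s → ∑ p ∈ t, 1 / ((p:ℕ):ℝ)^2 ≤ T) (R : ℝ) (hR : 0 < R) :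
    ((BN {v | v ≠ 0 ∧ ∃ p : Nat.Primes, p ∉ s ∧ Dv p v} R).ncard : ℝ) ≤ 9 * T * R^2 := by
  classical
  let P : Finset Nat.Primes :=
    (Finset.subtype Nat.Prime (Finset.range (⌊R⌋₊+1)) : Finset Nat.Primes).filter (· ∉ s)
  have hP : ∀ p : Nat.Primes, p ∈ P ↔ ((p:ℕ):ℝ) ≤ R ∧ p ∉ s := by
    intro p
    have hm : p ∈ (Finset.subtype Nat.Prime (Finset.range (⌊R⌋₊+1)) : Finset Nat.Primes) ↔
        (p:ℕ) ∈ Finset.range (⌊R⌋₊+1) := Finset.mem_subtype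
    have hm2 : p ∈ P ↔ p ∈ (Finset.subtype Nat.Prime (Finset.range (⌊R⌋₊+1)) : Finset Nat.Primes) ∧ p ∉ s :=
      Finset.mem_filter
    rw [hm2, hm, Finset.mem_range, Nat.lt_succ_iff, Nat.le_floor_iff hR.le]
  let f : Nat.Primes → Set (ℤ × ℤ) := fun p =>
    (fun w : ℤ × ℤ => (((p:ℕ):ℤ) * w.1, ((p:ℕ):ℤ) * w.2)) '' BN Set.univ (R / (p:ℕ))
  have hf : ∀ p, (f p).Finite := fun p => (BN_finite _ _).image _
  have hsub : BN {v | v ≠ 0 ∧ ∃ p : Nat.Primes, p ∉ s ∧ Dv p v} R ⊆ ⋃ p ∈ P, f p := by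
    rintro ⟨v1, v2⟩ ⟨⟨hv, p, hps, ⟨a, ha⟩, ⟨b, hb⟩⟩, h⟩
    simp only at ha hb h
    subst ha hb
    have hp0 : (0:ℝ) < (p:ℕ) := by exact_mod_cast p.2.pos
    push_cast at h
    have h' : ((a:ℝ))^2 + (b:ℝ)^2 < (R / (p:ℕ))^2 := by
      rw [div_pow, lt_div_iff₀ (by positivity)]
      nlinarith
    have hge : (1:ℝ) ≤ (a:ℝ)^2 + (b:ℝ)^2 := by
      have : (1:ℤ) ≤ a^2 + b^2 := by
        by_contra hlt
        have ha : a = 0 := by nlinarith [sq_nonneg a, sq_nonneg b]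
        have hb : b = 0 := by nlinarith [sq_nonneg a, sq_nonneg b]
        exact hv (by simp [ha, hb])
      exact_mod_cast this
    have hpR : ((p:ℕ):ℝ) ≤ R := by
      have h1 : 1 < R / (p:ℕ) := by
        have : 0 < R / (p:ℕ) := by positivity
        nlinarith
      exact ((one_lt_div hp0).1 h1).le
    simp only [Set.mem_iUnion]
    exact ⟨p, (hP p).2 ⟨hpR, hps⟩, (a, b), ⟨trivial, h'⟩, rfl⟩
  have hcard : ∀ p ∈ P, ((f p).ncard : ℝ) ≤ 9 * R^2 * (1 / ((p:ℕ):ℝ)^2) := by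
    intro p hp
    have hpR := ((hP p).1 hp).1
    have hp0 : (0:ℝ) < (p:ℕ) := by exact_mod_cast p.2.pos
    have h1 : (f p).ncard ≤ (BN Set.univ (R / (p:ℕ))).ncard := Set.ncard_image_le (BN_finite _ _)
    have h2 := Set.ncard_le_ncard (BN_subset Set.univ (R / (p:ℕ))) (Finset.finite_toSet _)
    rw [Set.ncard_coe_finset, Finset.card_product, Int.card_Icc] at h2
    set r := R / (p:ℕ) with hr
    have hr1 : 1 ≤ r := (one_le_div hp0).2 hpR
    rw [abs_of_nonneg (by linarith)] at h2
    have hk1 : 1 ≤ ⌊r⌋ := by rw [Int.le_floor]; simpa using hr1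
    have hk2 : (⌊r⌋:ℝ) ≤ r := Int.floor_le r
    have h3 : (((⌊r⌋ + 1 - -⌊r⌋).toNat : ℕ) : ℝ) ≤ 3 * r := by
      have : (((⌊r⌋ + 1 - -⌊r⌋).toNat : ℕ) : ℝ) = ((⌊r⌋ + 1 - -⌊r⌋ : ℤ) : ℝ) := by
        rw [← Int.cast_natCast, Int.toNat_of_nonneg (by linarith)]
      rw [this]
      have hk1' : (1:ℝ) ≤ ⌊r⌋ := by exact_mod_cast hk1
      push_cast
      linarith
    have h4 : ((f p).ncard : ℝ) ≤ (((⌊r⌋ + 1 - -⌊r⌋).toNat : ℕ) : ℝ) * (((⌊r⌋ + 1 - -⌊r⌋).toNat : ℕ) : ℝ) := by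
      exact_mod_cast h1.trans h2
    calc ((f p).ncard : ℝ) ≤ _ := h4
      _ ≤ (3 * r) * (3 * r) := by gcongr
      _ = _ := by rw [hr]; field_simp; ring
  have h1 := Set.ncard_le_ncard hsub (P.finite_toSet.biUnion (fun p _ => hf p))
  have h2 := h1.trans (Finset.set_ncard_biUnion_le P f)
  calc _ ≤ ((∑ p ∈ P, (f p).ncard : ℕ) : ℝ) := by exact_mod_cast h2
    _ ≤ ∑ p ∈ P, 9 * R^2 * (1 / ((p:ℕ):ℝ)^2) := by push_cast; exact Finset.sum_le_sum hcard
    _ = 9 * R^2 * ∑ p ∈ P, (1 / ((p:ℕ):ℝ)^2) := by rw [Finset.mul_sum]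
    _ ≤ 9 * R^2 * T := by
        gcongr
        apply hT
        rw [Finset.disjoint_left]
        intro p hp; exact ((hP p).1 hp).2
    _ = _ := by ring

lemma mem_Vis_iff (v : ℤ × ℤ) : v ∈ Vis ↔ ∀ p : Nat.Primes, ¬ Dv p v := by
  have e : ∀ p : ℕ, p ∣ Int.gcd v.1 v.2 ↔ Dv p v := by
    intro p
    rw [← Int.natCast_dvd_natCast, Int.dvd_coe_gcd_iff]; rfl
  change Int.gcd v.1 v.2 = 1 ↔ _
  rw [Nat.eq_one_iff_not_exists_prime_dvd]
  simp only [e]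
  exact ⟨fun h p => h p p.2, fun h p hp => h ⟨p, hp⟩⟩

lemma Gd_sub (x : ℤ × ℤ) (s : Finset Nat.Primes) (T : ℝ)
    (hT : ∀ t : Finset Nat.Primes, Disjoint t s → ∑ p ∈ t, 1 / ((p:ℕ):ℝ)^2 ≤ T) (R : ℝ)
    (hR : 0 < R) (hRx : |(x.1:ℝ)| + |(x.2:ℝ)| ≤ R) :
    ((BN (Gd x s) R).ncard : ℝ) ≤ (BN (Gd x Set.univ) R).ncard + 2 + 45 * T * R^2 := by
  classical
  have hT0 : 0 ≤ T := by simpa using hT ∅ (by simp)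
  set X : ℝ := |(x.1:ℝ)| + |(x.2:ℝ)| with hX
  have hX0 : 0 ≤ X := by positivity
  let E := {v : ℤ × ℤ | v ≠ 0 ∧ ∃ p : Nat.Primes, p ∉ s ∧ Dv p v}
  have hsub : BN (Gd x s) R ⊆ ((BN (Gd x Set.univ) R ∪ {0, -x}) ∪ BN E R) ∪
      (fun v => v - x) '' BN E (R + X) := by
    rintro v ⟨hv, h⟩
    by_contra hn
    simp only [Set.mem_union, not_or] at hn
    obtain ⟨⟨⟨h1, h2⟩, h3⟩, h4⟩ := hn
    simp only [Set.mem_insert_iff, Set.mem_singleton_iff, not_or] at h2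
    refine h1 ⟨fun p _ => ?_, h⟩
    by_cases hp : p ∈ s
    · exact hv p hp
    · constructor
      · intro hd
        exact h3 ⟨⟨h2.1, p, hp, hd⟩, h⟩
      · intro hd
        refine h4 ⟨v + x, ⟨⟨fun h0 => h2.2 (eq_neg_of_add_eq_zero_left h0), p, hp, hd⟩, ?_⟩, by simp⟩
        have := tri (x.1:ℝ) (x.2:ℝ) hR h
        rw [← hX] at this
        simpa using this
  have hfin : (((BN (Gd x Set.univ) R ∪ {0, -x}) ∪ BN E R) ∪
      (fun v => v - x) '' BN E (R + X)).Finite :=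
    (((BN_finite _ _).union (by simp)).union (BN_finite _ _)).union ((BN_finite _ _).image _)
  have h1 := Set.ncard_le_ncard hsub hfin
  have h2 := Set.ncard_union_le ((BN (Gd x Set.univ) R ∪ {0, -x}) ∪ BN E R)
    ((fun v => v - x) '' BN E (R + X))
  have h3 := Set.ncard_union_le (BN (Gd x Set.univ) R ∪ {0, -x}) (BN E R)
  have h4 := Set.ncard_union_le (BN (Gd x Set.univ) R) {0, -x}
  have h5 : ({0, -x} : Set (ℤ × ℤ)).ncard ≤ 2 := (Set.ncard_insert_le _ _).trans (by simp)
  have h6 : ((fun v => v - x) '' BN E (R + X)).ncard ≤ (BN E (R + X)).ncard :=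
    Set.ncard_image_le (BN_finite _ _)
  have h7 : (BN (Gd x s) R).ncard ≤ (BN (Gd x Set.univ) R).ncard + 2 + (BN E R).ncard + (BN E (R+X)).ncard := by
    omega
  have e1 := Ecard s T hT R hR
  have e2 := Ecard s T hT (R + X) (by linarith)
  have h8 : ((BN (Gd x s) R).ncard : ℝ) ≤ (BN (Gd x Set.univ) R).ncard + 2 + (BN E R).ncard + (BN E (R+X)).ncard := by
    exact_mod_cast h7
  have e3 : 9 * T * (R + X)^2 ≤ 9 * T * (2 * R)^2 := by gcongr; linarith
  have e1' : ((BN E R).ncard : ℝ) ≤ 9 * T * R^2 := e1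
  have e2' : ((BN E (R+X)).ncard : ℝ) ≤ 9 * T * (R+X)^2 := e2
  nlinarith

lemma summable_primes : Summable (fun p : Nat.Primes => 1 / ((p:ℕ):ℝ)^2) :=
  (Real.summable_one_div_nat_pow.2 one_lt_two).comp_injective Subtype.val_injective

lemma multipliable_cc (c : Nat.Primes → ℝ) (hc : ∀ p, |c p| ≤ 2) :
    Multipliable (fun p : Nat.Primes => 1 - c p / ((p:ℕ):ℝ)^2) := by
  have : Summable (fun p : Nat.Primes => -(c p / ((p:ℕ):ℝ)^2)) := by
    refine Summable.of_norm_bounded (summable_primes.mul_left 2) ?_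
    intro p
    rw [norm_neg, norm_div, Real.norm_eq_abs, Real.norm_eq_abs, abs_of_nonneg (sq_nonneg ((p:ℕ):ℝ)),
      mul_one_div]
    gcongr
    exact hc p
  simpa only [sub_eq_add_neg] using Real.multipliable_one_add_of_summable this

lemma cc_abs (x : ℤ × ℤ) (p : ℕ) : |cc x p| ≤ 2 := by
  unfold cc; split_ifs <;> norm_num

lemma hasDens_main (x : ℤ × ℤ) :
    HasDens (Gd x Set.univ) (∏' p : Nat.Primes, (1 - cc x p / ((p:ℕ):ℝ)^2)) := by
  classical
  have hprod := (multipliable_cc (fun p => cc x p) (fun p => cc_abs x p)).hasProd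
  unfold HasDens
  rw [Metric.tendsto_atTop']
  intro ε hε
  obtain ⟨s0, hs0⟩ := summable_iff_vanishing_norm.1 summable_primes (ε / 60) (by positivity)
  have hev := (Metric.tendsto_nhds.1 hprod (ε/4) (by positivity))
  obtain ⟨s, hs1, hs⟩ := (hev.and (eventually_ge_atTop s0)).exists
  have hT : ∀ t : Finset Nat.Primes, Disjoint t s → ∑ p ∈ t, 1 / ((p:ℕ):ℝ)^2 ≤ ε / 60 := by
    intro t ht
    exact (le_abs_self _).trans (hs0 t (ht.mono_right hs)).le
  have hG : HasDens (Gd x s) (∏ p ∈ s, (1 - cc x p / ((p:ℕ):ℝ)^2)) := by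
    have := hasDens_Gd x s 1 0 one_pos (fun p _ => isCoprime_one_left)
    simpa [Cos] using this
  have hG' := Metric.tendsto_nhds.1 hG (ε/4) (by positivity)
  have hz : Tendsto (fun R : ℝ => 2 / (Real.pi * R^2)) atTop (𝓝 0) :=
    tendsto_const_nhds.div_atTop ((tendsto_pow_atTop two_ne_zero).const_mul_atTop Real.pi_pos)
  have hz' := hz.eventually_lt_const (show 0 < ε / 4 by positivity)
  obtain ⟨N, hN⟩ := eventually_atTop.1 (hG'.and (hz'.and ((eventually_gt_atTop 0).and
    (eventually_ge_atTop (|(x.1:ℝ)| + |(x.2:ℝ)|)))))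
  refine ⟨N, fun R hR => ?_⟩
  obtain ⟨k1, k2, k3, k4⟩ := hN R hR.le
  have hpos : 0 < Real.pi * R^2 := by have := Real.pi_pos; positivity
  have u1 : dens (Gd x Set.univ) R ≤ dens (Gd x s) R := by
    unfold dens
    refine div_le_div_of_nonneg_right (Nat.cast_le.2 ?_) hpos.le
    exact Set.ncard_le_ncard (fun v hv => ⟨fun p _ => hv.1 p trivial, hv.2⟩) (BN_finite _ _)
  have u2 : dens (Gd x s) R ≤ dens (Gd x Set.univ) R + 2 / (Real.pi * R^2) + ε / 4 := by
    have h := Gd_sub x s _ hT R k3 k4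
    unfold dens
    rw [← add_div, div_le_iff₀ hpos, add_mul, div_mul_cancel₀ _ hpos.ne']
    refine h.trans ?_
    have := Real.pi_gt_three
    have hR2 : 0 < ε * R^2 := by positivity
    nlinarith
  rw [Real.dist_eq, abs_lt] at k1 hs1 ⊢
  constructor <;> linarith [k1.1, k1.2, hs1.1, hs1.2]

lemma card_eq (x : ℤ × ℤ) (R : ℝ) : (Nat.card {v : ℤ × ℤ // v ∈ Vis ∧ v + x ∈ Vis ∧
          (v.1 : ℝ)^2 + (v.2 : ℝ)^2 < R^2} : ℝ) / (Real.pi * R^2) = dens (Gd x Set.univ) R := by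
  unfold dens
  congr 2
  rw [← Nat.card_coe_set_eq]
  refine Nat.card_congr (Equiv.subtypeEquivRight ?_)
  intro v
  simp only [mem_Vis_iff, BN, Gd, Set.mem_ofPred_eq, Set.mem_univ, true_imp_iff, forall_and]
  tauto

/-- For each `x ∈ ℤ²` the natural autocorrelation coefficient
`η(x) = lim_{R→∞} |V ∩ (−x+V) ∩ B_R(0)|/(πR²)` exists; for `x = 0` it equals
`∏_p (1 − p⁻²) = 1/ζ(2)`, and for `x ≠ 0` it equals
`ξ ∏_{p ∣ gcd(x)} (1 + 1/(p²−2))` with `ξ = ∏_p (1 − 2p⁻²)`. -/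
theorem visible_autocorrelation (x : ℤ × ℤ) :
    (x = 0 →
      Tendsto (fun R : ℝ =>
        (Nat.card {v : ℤ × ℤ // v ∈ Vis ∧ v + x ∈ Vis ∧
          (v.1 : ℝ)^2 + (v.2 : ℝ)^2 < R^2} : ℝ) / (Real.pi * R^2))
        atTop (𝓝 (∏' p : Nat.Primes, (1 - 1 / ((p : ℕ) : ℝ)^2)))) ∧
    (x ≠ 0 →
      Tendsto (fun R : ℝ =>
        (Nat.card {v : ℤ × ℤ // v ∈ Vis ∧ v + x ∈ Vis ∧
          (v.1 : ℝ)^2 + (v.2 : ℝ)^2 < R^2} : ℝ) / (Real.pi * R^2))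
        atTop (𝓝 ((∏' p : Nat.Primes, (1 - 2 / ((p : ℕ) : ℝ)^2)) *
          ∏ p ∈ (Int.gcd x.1 x.2).primeFactors, (1 + 1 / ((p : ℝ)^2 - 2))))) := by
  classical
  simp only [card_eq]
  have hmain := hasDens_main x
  unfold HasDens at hmain
  constructor
  · rintro rfl
    convert! hmain using 5 with p
    simp [cc, Dv]
  · intro hx
    convert! hmain using 2
    have hg : Int.gcd x.1 x.2 ≠ 0 := by
      intro h
      rw [Int.gcd_eq_zero_iff] at h
      exact hx (Prod.ext h.1 h.2)
    let F : ℕ → ℝ := fun p => 1 + 1 / ((p : ℝ)^2 - 2)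
    let t : Finset Nat.Primes := Finset.subtype Nat.Prime (Int.gcd x.1 x.2).primeFactors
    have ht : ∀ p : Nat.Primes, p ∈ t ↔ Dv p x := by
      intro p
      have hm : p ∈ t ↔ (p:ℕ) ∈ (Int.gcd x.1 x.2).primeFactors := Finset.mem_subtype
      rw [hm, Nat.mem_primeFactors_of_ne_zero hg, ← Int.natCast_dvd_natCast,
        Int.dvd_coe_gcd_iff]
      exact ⟨fun h => h.2, fun h => ⟨p.2, h⟩⟩
    have h1 : HasProd (fun p : Nat.Primes => if p ∈ t then F p else 1)
        (∏ p ∈ t, if p ∈ t then F p else 1) :=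
      hasProd_prod_of_ne_finset_one (by intro p hp; simp [hp])
    have h2 : (∏ p ∈ t, if p ∈ t then F p else 1) = ∏ p ∈ (Int.gcd x.1 x.2).primeFactors, F p := by
      rw [Finset.prod_congr rfl (fun p hp => if_pos hp)]
      exact Finset.prod_subtype_of_mem F (fun p hp => Nat.prime_of_mem_primeFactors hp)
    rw [h2] at h1
    have h3 := (multipliable_cc (fun _ => 2) (by simp)).hasProd.mul h1
    rw [← h3.tprod_eq]
    congr 1
    ext p
    have hp2 : (2:ℝ) ≤ (p:ℕ) := by exact_mod_cast p.2.two_le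
    have : ((p:ℕ):ℝ)^2 - 2 ≠ 0 := by nlinarith
    by_cases hp : p ∈ t
    · have hd := (ht p).1 hp
      simp only [hp, if_true, cc, hd, F]
      field_simp
      ring
    · have hd : ¬ Dv p x := fun h => hp ((ht p).2 h)
      simp [hp, cc, hd]
end

section
/- The orbit closure of V under ℤ²-translations equals the set of admissible subsets of ℤ²: identifying subsets of ℤ² with elements of {0,1}^{ℤ²} carrying the product topology, the closure of {t + V : t ∈ ℤ²} is exactly {A ⊆ ℤ² : |A_p| < p² for every prime p}. -/
/-- Reduction of a subset of `ℤ²` modulo `m`. -/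
def redSet (m : ℕ) (A : Set (ℤ × ℤ)) : Set (ZMod m × ZMod m) :=
  (fun x : ℤ × ℤ => ((x.1 : ZMod m), (x.2 : ZMod m))) '' A

theorem aux_crt (S : Finset ℕ) (hS : ∀ p ∈ S, p.Prime) (r : ℕ → ℤ) (C : ℤ) :
    ∃ t : ℤ, C < t ∧ ∀ p ∈ S, (p : ℤ) ∣ t - r p := by
  obtain ⟨t, ht⟩ : ∃ t : ℤ, ∀ p ∈ S, (p : ℤ) ∣ t - r p := by
    induction S using Finset.induction_on with
    | empty => exact ⟨0, by simp⟩
    | insert q S hq ih =>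
      obtain ⟨t, ht⟩ := ih (fun p hp => hS p (Finset.mem_insert_of_mem hp))
      have hc : IsCoprime (q : ℤ) (∏ p ∈ S, (p : ℤ)) := by
        refine IsCoprime.prod_right fun p hp => ?_
        rw [Nat.isCoprime_iff_coprime]
        refine (Nat.coprime_primes (hS q (Finset.mem_insert_self _ _))
          (hS p (Finset.mem_insert_of_mem hp))).2 ?_
        rintro rfl
        exact hq hp
      obtain ⟨a, b, hab⟩ := hc
      refine ⟨t + b * (∏ p ∈ S, (p : ℤ)) * (r q - t), fun p hp => ?_⟩
      rcases Finset.mem_insert.1 hp with rfl | hp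
      · refine ⟨a * (t - r p), ?_⟩
        linear_combination (r p - t) * hab
      · have h1 := ht p hp
        have h2 : (p : ℤ) ∣ ∏ p ∈ S, (p : ℤ) := Finset.dvd_prod_of_mem (fun p : ℕ => (p : ℤ)) hp
        have h3 : (p : ℤ) ∣ b * (∏ p ∈ S, (p : ℤ)) * (r q - t) :=
          (h2.mul_left b).mul_right _
        have := h1.add h3
        rwa [sub_add_eq_add_sub] at this
  have hpos : 1 ≤ ∏ p ∈ S, (p : ℤ) := by
    have : 0 < ∏ p ∈ S, (p : ℤ) :=
      Finset.prod_pos fun p hp => by exact_mod_cast (hS p hp).pos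
    omega
  refine ⟨t + (∏ p ∈ S, (p : ℤ)) * (|t| + |C| + 1), ?_, fun p hp => ?_⟩
  · nlinarith [neg_abs_le t, le_abs_self C, abs_nonneg t, abs_nonneg C]
  · have h2 : (p : ℤ) ∣ ∏ p ∈ S, (p : ℤ) := Finset.dvd_prod_of_mem (fun p : ℕ => (p : ℤ)) hp
    have := (ht p hp).add (h2.mul_right (|t| + |C| + 1))
    rwa [sub_add_eq_add_sub] at this

theorem aux_pigeon (A : Finset (ℤ × ℤ)) (p : ℕ) (hp : p.Prime) (h : A.card < p) :
    ∃ c : ℤ, ∀ x ∈ A, ¬ (p : ℤ) ∣ x.2 - c := by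
  classical
  have : Fact p.Prime := ⟨hp⟩
  have hlt : (A.image (fun x : ℤ × ℤ => (x.2 : ZMod p))).card < Fintype.card (ZMod p) := by
    rw [ZMod.card]
    exact Finset.card_image_le.trans_lt h
  obtain ⟨y, hy⟩ : ∃ y, y ∉ A.image (fun x : ℤ × ℤ => (x.2 : ZMod p)) := by
    by_contra hcon
    push Not at hcon
    rw [Finset.eq_univ_of_forall hcon, Finset.card_univ] at hlt
    exact lt_irrefl _ hlt
  obtain ⟨c, rfl⟩ := ZMod.intCast_surjective y
  refine ⟨c, fun x hx hd => hy ?_⟩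
  exact Finset.mem_image.2 ⟨x, hx, ((ZMod.intCast_eq_intCast_iff_dvd_sub _ _ _).2 hd).symm⟩

theorem aux_adm (f : ℤ × ℤ → Bool) (p : ℕ) (hp : p.Prime) :
    Set.ncard (redSet p {x : ℤ × ℤ | f x = true}) < p ^ 2 ↔
    ∃ r : ℤ × ℤ, ∀ x : ℤ × ℤ, f x = true → ¬ ((p : ℤ) ∣ x.1 - r.1 ∧ (p : ℤ) ∣ x.2 - r.2) := by
  have : Fact p.Prime := ⟨hp⟩
  have hcard : Set.ncard (Set.univ : Set (ZMod p × ZMod p)) = p ^ 2 := by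
    rw [Set.ncard_univ, Nat.card_prod, Nat.card_zmod, sq]
  constructor
  · intro h
    obtain ⟨y, hy⟩ : ∃ y, y ∉ redSet p {x : ℤ × ℤ | f x = true} := by
      by_contra hcon
      push Not at hcon
      rw [Set.eq_univ_of_forall hcon, hcard] at h
      exact lt_irrefl _ h
    obtain ⟨y1, y2⟩ := y
    obtain ⟨a, rfl⟩ := ZMod.intCast_surjective y1
    obtain ⟨b, rfl⟩ := ZMod.intCast_surjective y2
    refine ⟨(a, b), fun x hx hd => hy ⟨x, hx, ?_⟩⟩
    exact Prod.ext ((ZMod.intCast_eq_intCast_iff_dvd_sub _ _ _).2 hd.1).symm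
      ((ZMod.intCast_eq_intCast_iff_dvd_sub _ _ _).2 hd.2).symm
  · rintro ⟨r, hr⟩
    rw [← hcard]
    refine Set.ncard_lt_ncard ?_ (Set.toFinite _)
    rw [Set.ssubset_univ_iff]
    intro hcon
    have : (((r.1 : ZMod p), (r.2 : ZMod p))) ∈ redSet p {x : ℤ × ℤ | f x = true} := by
      rw [hcon]; trivial
    obtain ⟨x, hx, he⟩ := this
    have h1 := congrArg Prod.fst he
    have h2 := congrArg Prod.snd he
    exact hr x hx ⟨(ZMod.intCast_eq_intCast_iff_dvd_sub _ _ _).1 h1.symm,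
      (ZMod.intCast_eq_intCast_iff_dvd_sub _ _ _).1 h2.symm⟩

/-- Core construction: a finite pattern of an admissible set is realised by a translate. -/
theorem aux_core (A B : Finset (ℤ × ℤ)) (hAB : Disjoint A B)
    (hA : ∀ p : ℕ, p.Prime → ∃ r : ℤ × ℤ, ∀ x ∈ A,
      ¬ ((p : ℤ) ∣ x.1 - r.1 ∧ (p : ℤ) ∣ x.2 - r.2)) :
    ∃ t : ℤ × ℤ, (∀ x ∈ A, x - t ∈ Vis) ∧ ∀ x ∈ B, x - t ∉ Vis := by
  classical
  -- a bound on the differences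
  obtain ⟨N, hN⟩ : ∃ N : ℕ, ∀ x ∈ A, ∀ b ∈ B,
      (x.1 - b.1).natAbs ≤ N ∧ (x.2 - b.2).natAbs ≤ N := by
    refine ⟨∑ x ∈ A, ∑ b ∈ B, ((x.1 - b.1).natAbs + (x.2 - b.2).natAbs), fun x hx b hb => ?_⟩
    have h1 := Finset.single_le_sum (s := B)
      (f := fun b : ℤ × ℤ => (x.1 - b.1).natAbs + (x.2 - b.2).natAbs)
      (fun _ _ => Nat.zero_le _) hb
    have h2 := Finset.single_le_sum (s := A)
      (f := fun x : ℤ × ℤ => ∑ b ∈ B, ((x.1 - b.1).natAbs + (x.2 - b.2).natAbs))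
      (fun _ _ => Nat.zero_le _) hx
    omega
  obtain ⟨q, hqp, hqN, hqi⟩ : ∃ q : ℤ × ℤ → ℕ, (∀ b, (q b).Prime) ∧ (∀ b, N < q b) ∧
      Function.Injective q := by
    refine ⟨fun b => Nat.nth Nat.Prime (N + 1 + Encodable.encode b),
      fun b => Nat.nth_mem_of_infinite Nat.infinite_setOfPred_prime _, fun b => ?_, ?_⟩
    · have : N + 1 + Encodable.encode b ≤ Nat.nth Nat.Prime (N + 1 + Encodable.encode b) :=
        (Nat.nth_strictMono Nat.infinite_setOfPred_prime).le_apply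
      show N < Nat.nth Nat.Prime (N + 1 + Encodable.encode b)
      omega
    · intro a b hab
      have := Nat.nth_injective Nat.infinite_setOfPred_prime hab
      exact Encodable.encode_injective (by omega)
  -- residues
  obtain ⟨r, hr, hrB⟩ : ∃ r : ℕ → ℤ × ℤ, (∀ p : ℕ, p.Prime → ∀ x ∈ A,
      ¬ ((p : ℤ) ∣ x.1 - (r p).1 ∧ (p : ℤ) ∣ x.2 - (r p).2)) ∧ ∀ b ∈ B, r (q b) = b := by
    have : ∀ p : ℕ, ∃ r : ℤ × ℤ, (p.Prime → ∀ x ∈ A,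
      ¬ ((p : ℤ) ∣ x.1 - r.1 ∧ (p : ℤ) ∣ x.2 - r.2)) ∧ ∀ b ∈ B, q b = p → r = b := by
      intro p
      by_cases hp : ∃ b ∈ B, q b = p
      · obtain ⟨b, hb, rfl⟩ := hp
        refine ⟨b, fun _ x hx hd => ?_, fun b' _ h => (hqi h).symm⟩
        obtain ⟨n1, n2⟩ := hN x hx b hb
        have hq := hqN b
        have e1 := Int.eq_zero_of_abs_lt_dvd hd.1 (by rw [Int.abs_eq_natAbs]; omega)
        have e2 := Int.eq_zero_of_abs_lt_dvd hd.2 (by rw [Int.abs_eq_natAbs]; omega)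
        have : x = b := Prod.ext (by omega) (by omega)
        exact Finset.disjoint_left.1 hAB hx (this ▸ hb)
      · by_cases hpp : p.Prime
        · obtain ⟨r, hr⟩ := hA p hpp
          exact ⟨r, fun _ => hr, fun b hb h => absurd ⟨b, hb, h⟩ hp⟩
        · exact ⟨0, fun h => absurd h hpp, fun b hb h => absurd ⟨b, hb, h⟩ hp⟩
    choose r hr using this
    exact ⟨r, fun p => (hr p).1, fun b hb => (hr _).2 b hb rfl⟩
  let S : Finset ℕ := (Finset.range (A.card + 1)).filter Nat.Prime ∪ B.image q
  have hS : ∀ p ∈ S, p.Prime := by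
    intro p hp
    rcases Finset.mem_union.1 hp with h | h
    · exact (Finset.mem_filter.1 h).2
    · obtain ⟨b, _, rfl⟩ := Finset.mem_image.1 h
      exact hqp b
  have hSB : ∀ b ∈ B, q b ∈ S := fun b hb =>
    Finset.mem_union_right _ (Finset.mem_image_of_mem q hb)
  have hSA : ∀ p : ℕ, p.Prime → p ∉ S → A.card < p := by
    intro p hp hpS
    by_contra hle
    exact hpS (Finset.mem_union_left _ (Finset.mem_filter.2
      ⟨Finset.mem_range.2 (by omega), hp⟩))
  obtain ⟨t1, ht1, h1⟩ := aux_crt S hS (fun p => (r p).1) (∑ x ∈ A, |x.1|)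
  have hne : ∀ x ∈ A, x.1 - t1 ≠ 0 := by
    intro x hx h0
    have h2 := Finset.single_le_sum (s := A) (f := fun x : ℤ × ℤ => |x.1|)
      (fun _ _ => abs_nonneg _) hx
    have h3 := le_abs_self x.1
    omega
  -- second coordinate
  let S' : Finset ℕ := S ∪ A.biUnion (fun x => (x.1 - t1).natAbs.primeFactors)
  have hS' : ∀ p ∈ S', p.Prime := by
    intro p hp
    rcases Finset.mem_union.1 hp with h | h
    · exact hS p h
    · obtain ⟨x, _, hx⟩ := Finset.mem_biUnion.1 h
      exact Nat.prime_of_mem_primeFactors hx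
  have hs : ∀ p : ℕ, ∃ c : ℤ, (p ∈ S → c = (r p).2) ∧
      (p.Prime → p ∉ S → ∀ x ∈ A, ¬ (p : ℤ) ∣ x.2 - c) := by
    intro p
    by_cases hp : p ∈ S
    · exact ⟨_, fun _ => rfl, fun _ h => absurd hp h⟩
    · by_cases hpp : p.Prime
      · obtain ⟨c, hc⟩ := aux_pigeon A p hpp (hSA p hpp hp)
        exact ⟨c, fun h => absurd h hp, fun _ _ => hc⟩
      · exact ⟨0, fun h => absurd h hp, fun h => absurd h hpp⟩
  choose s hs1 hs2 using hs
  obtain ⟨t2, -, h2⟩ := aux_crt S' hS' s 0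
  have h2S : ∀ p ∈ S, (p : ℤ) ∣ t2 - (r p).2 := by
    intro p hp
    rw [← hs1 p hp]
    exact h2 p (Finset.mem_union_left _ hp)
  refine ⟨(t1, t2), fun x hx => ?_, fun b hb hv => ?_⟩
  · show Int.gcd (x.1 - t1) (x.2 - t2) = 1
    by_contra hg
    obtain ⟨p, hp, hpd⟩ := Nat.exists_prime_and_dvd hg
    have d1 : (p : ℤ) ∣ x.1 - t1 := (Int.natCast_dvd_natCast.2 hpd).trans (Int.gcd_dvd_left ..)
    have d2 : (p : ℤ) ∣ x.2 - t2 := (Int.natCast_dvd_natCast.2 hpd).trans (Int.gcd_dvd_right ..)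
    by_cases hpS : p ∈ S
    · refine hr p hp x hx ⟨?_, ?_⟩
      · have := d1.add (h1 p hpS)
        simpa using this
      · have := d2.add (h2S p hpS)
        simpa using this
    · have hpS' : p ∈ S' := by
        refine Finset.mem_union_right _ (Finset.mem_biUnion.2 ⟨x, hx, ?_⟩)
        exact Nat.mem_primeFactors.2 ⟨hp, Int.natCast_dvd.1 d1, by
          simpa using hne x hx⟩
      refine hs2 p hp hpS x hx ?_
      have := d2.add (h2 p hpS')
      simpa using this
  · have hv' : Int.gcd (b.1 - t1) (b.2 - t2) = 1 := hv
    have e1 := h1 _ (hSB b hb)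
    have e2 := h2S _ (hSB b hb)
    simp only [hrB b hb] at e1 e2
    rw [dvd_sub_comm] at e1 e2
    have := Int.dvd_coe_gcd e1 e2
    rw [hv'] at this
    exact (hqp b).one_lt.ne' (by exact_mod_cast Int.eq_one_of_dvd_one (by positivity) this)

/-- Identifying subsets of `ℤ²` with configurations in `{0,1}^{ℤ²}` (product topology,
`Bool` discrete), the closure of the translation orbit `{t + V : t ∈ ℤ²}` is exactly the
set of admissible configurations, i.e. those `A ⊆ ℤ²` with `|A_p| < p²` for every prime. -/
theorem hull_eq_admissible :
    closure {f : (ℤ × ℤ) → Bool | ∃ t : ℤ × ℤ, ∀ x : ℤ × ℤ, f x = true ↔ x - t ∈ Vis}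
      = {f : (ℤ × ℤ) → Bool | ∀ p : ℕ, p.Prime →
          Set.ncard (redSet p {x : ℤ × ℤ | f x = true}) < p^2} := by
  ext f
  simp only [Set.mem_ofPred_eq]
  constructor
  · intro hf p hp
    have : Fact p.Prime := ⟨hp⟩
    by_contra hcon
    rw [aux_adm f p hp] at hcon
    push Not at hcon
    let g : ZMod p × ZMod p → ℤ × ℤ := fun y => ((y.1.val : ℤ), (y.2.val : ℤ))
    choose w hw using fun y => hcon (g y)
    have hopen : IsOpen (⋂ y : ZMod p × ZMod p, (fun h : ℤ × ℤ → Bool => h (w y)) ⁻¹' {true}) :=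
      isOpen_iInter_of_finite fun y =>
        (isOpen_discrete ({true} : Set Bool)).preimage (continuous_apply (w y))
    obtain ⟨h, hh, t, ht⟩ := mem_closure_iff.1 hf _ hopen
      (Set.mem_iInter.2 fun y => (hw y).1)
    let y : ZMod p × ZMod p := ((t.1 : ZMod p), (t.2 : ZMod p))
    have hv : Int.gcd ((w y).1 - t.1) ((w y).2 - t.2) = 1 :=
      (ht (w y)).1 (Set.mem_iInter.1 hh y)
    have key : ∀ a : ℤ, (p : ℤ) ∣ (((a : ZMod p).val : ℤ)) - a := by
      intro a
      rw [← ZMod.intCast_eq_intCast_iff_dvd_sub]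
      simp
    have d1 := (hw y).2.1.add (key t.1)
    have d2 := (hw y).2.2.add (key t.2)
    have d1' : (p : ℤ) ∣ (w y).1 - t.1 := by simpa [g, y] using d1
    have d2' : (p : ℤ) ∣ (w y).2 - t.2 := by simpa [g, y] using d2
    have := Int.dvd_coe_gcd d1' d2'
    rw [hv] at this
    exact hp.one_lt.ne' (by exact_mod_cast Int.eq_one_of_dvd_one (by positivity) this)
  · intro hf
    rw [mem_closure_iff]
    intro o ho hfo
    obtain ⟨I, u, hu, hsub⟩ := isOpen_pi_iff.1 ho f hfo
    obtain ⟨t, htA, htB⟩ := aux_core (I.filter (fun x => f x = true))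
      (I.filter (fun x => ¬ f x = true)) (Finset.disjoint_filter_filter_not _ _ _) (by
        intro p hp
        obtain ⟨r, hr⟩ := (aux_adm f p hp).1 (hf p hp)
        exact ⟨r, fun x hx => hr x (Finset.mem_filter.1 hx).2⟩)
    classical
    refine ⟨fun x => decide (x - t ∈ Vis), hsub ?_, t, fun x => by simp⟩
    intro x hx
    have hx' : x ∈ I := hx
    have : decide (x - t ∈ Vis) = f x := by
      by_cases h : f x = true
      · rw [h]
        exact decide_eq_true (htA x (Finset.mem_filter.2 ⟨hx', h⟩))
      · rw [Bool.not_eq_true _ |>.mp h]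
        exact decide_eq_false (htB x (Finset.mem_filter.2 ⟨hx', h⟩))
    show decide (x - t ∈ Vis) ∈ u x
    rw [this]
    exact (hu x hx').2
end

section
/- Every admissible subset of ℤ² contains holes of arbitrary size: if A ⊆ ℤ² satisfies |A_p| < p² for every prime p, then for every ρ > 0 there exists t ∈ ℤ² such that A ∩ B_ρ(t) = ∅. Consequently, every element of the translation orbit closure of V contains arbitrarily large holes, and the empty configuration is the unique minimal subsystem of the hull of V. -/
/-- The translation action on configurations: `shift t f` represents `A − t` when `f`
represents `A`. -/
def shift (t : ℤ × ℤ) (f : (ℤ × ℤ) → Bool) : (ℤ × ℤ) → Bool := fun x => f (x + t)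

/-- The hull of the visible points: the closure of the translation orbit of `V` in the
product topology on `{0,1}^{ℤ²}`. -/
def hullV : Set ((ℤ × ℤ) → Bool) :=
  closure {f : (ℤ × ℤ) → Bool | ∃ t : ℤ × ℤ, ∀ x : ℤ × ℤ, f x = true ↔ x + t ∈ Vis}

theorem exists_missing (A : Set (ℤ × ℤ)) (p : ℕ) (hp : p.Prime)
    (h : Set.ncard (redSet p A) < p ^ 2) : ∃ r : ℕ × ℕ, ∀ a ∈ A,
      ¬ ((a.1 : ZMod p) = (r.1 : ZMod p) ∧ (a.2 : ZMod p) = (r.2 : ZMod p)) := by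
  have : Fact p.Prime := ⟨hp⟩
  have hne : redSet p A ≠ Set.univ := by
    intro hu
    rw [hu, Set.ncard_univ, Nat.card_prod, Nat.card_zmod] at h
    nlinarith
  obtain ⟨c, hc⟩ := (Set.ne_univ_iff_exists_notMem _).1 hne
  refine ⟨(c.1.val, c.2.val), ?_⟩
  rintro a ha ⟨h1, h2⟩
  apply hc
  refine ⟨a, ha, ?_⟩
  simp only [ZMod.natCast_val, ZMod.cast_id', id_eq] at h1 h2
  exact Prod.ext h1 h2

theorem exists_crt (F : Finset (ℤ × ℤ)) (q : ℤ × ℤ → ℕ) (hq : ∀ x, (q x).Prime)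
    (hinj : Function.Injective q) (a : ℤ × ℤ → ℤ) :
    ∃ k : ℤ, ∀ x ∈ F, (k : ZMod (q x)) = (a x : ZMod (q x)) := by
  have hpp : Set.Pairwise (F : Set (ℤ × ℤ)) (Function.onFun Nat.Coprime q) := by
    intro x _ y _ hxy
    exact (Nat.coprime_primes (hq x) (hq y)).2 (fun h => hxy (hinj h))
  obtain ⟨k, hk⟩ := Nat.chineseRemainderOfFinset (fun x => ((a x : ZMod (q x))).val) q F
    (fun x _ => (hq x).ne_zero) hpp
  refine ⟨k, fun x hx => ?_⟩
  have : Fact (q x).Prime := ⟨hq x⟩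
  have := (ZMod.natCast_eq_natCast_iff _ _ _).2 (hk x hx)
  simpa using this

theorem exists_hole (A : Set (ℤ × ℤ))
    (h : ∀ p : ℕ, p.Prime → Set.ncard (redSet p A) < p ^ 2) (F : Finset (ℤ × ℤ)) :
    ∃ t : ℤ × ℤ, ∀ x ∈ F, x + t ∉ A := by
  choose! r hr using fun p hp => exists_missing A p hp (h p hp)
  obtain ⟨e, he⟩ := exists_injective_nat (ℤ × ℤ)
  let q : ℤ × ℤ → ℕ := fun x => Nat.nth Nat.Prime (e x)
  have hq : ∀ x, (q x).Prime := fun x => Nat.prime_nth_prime _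
  have hinj : Function.Injective q :=
    (Nat.nth_injective Nat.infinite_setOfPred_prime).comp he
  obtain ⟨k, hk⟩ := exists_crt F q hq hinj (fun x => (r (q x)).1 - x.1)
  obtain ⟨l, hl⟩ := exists_crt F q hq hinj (fun x => (r (q x)).2 - x.2)
  refine ⟨(k, l), fun x hx hA => hr (q x) (hq x) _ hA ⟨?_, ?_⟩⟩
  · have := hk x hx
    push_cast at this
    simp [this]
  · have := hl x hx
    push_cast at this
    simp [this]

theorem exists_ball_hole (A : Set (ℤ × ℤ))
    (h : ∀ p : ℕ, p.Prime → Set.ncard (redSet p A) < p ^ 2) (ρ : ℝ) (hρ : 0 < ρ) :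
    ∃ t : ℤ × ℤ, ∀ a ∈ A,
        ¬ (((a.1 : ℝ) - (t.1 : ℝ))^2 + ((a.2 : ℝ) - (t.2 : ℝ))^2 < ρ^2) := by
  obtain ⟨t, ht⟩ := exists_hole A h (Finset.Icc (-⌈ρ⌉) ⌈ρ⌉ ×ˢ Finset.Icc (-⌈ρ⌉) ⌈ρ⌉)
  refine ⟨t, fun a ha hlt => ?_⟩
  have hc : ρ ≤ ⌈ρ⌉ := Int.le_ceil ρ
  have h1 := abs_lt_of_sq_lt_sq (a := (a.1 : ℝ) - t.1) (b := ρ)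
    (by nlinarith [sq_nonneg ((a.2 : ℝ) - t.2)]) hρ.le
  have h2 := abs_lt_of_sq_lt_sq (a := (a.2 : ℝ) - t.2) (b := ρ)
    (by nlinarith [sq_nonneg ((a.1 : ℝ) - t.1)]) hρ.le
  rw [abs_lt] at h1 h2
  refine ht (a - t) ?_ (by simpa using ha)
  simp only [Finset.mem_product, Finset.mem_Icc, Prod.fst_sub, Prod.snd_sub]
  refine ⟨⟨?_, ?_⟩, ?_, ?_⟩ <;> rify <;> linarith

theorem hull_admissible (f : ℤ × ℤ → Bool) (hf : f ∈ hullV) (p : ℕ) (hp : p.Prime) :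
    Set.ncard (redSet p {x | f x = true}) < p ^ 2 := by
  have : Fact p.Prime := ⟨hp⟩
  have hcard : Nat.card (ZMod p × ZMod p) = p ^ 2 := by
    rw [Nat.card_prod, Nat.card_zmod, sq]
  rw [← hcard]
  apply Set.ncard_lt_card
  intro hu
  have hx : ∀ c : ZMod p × ZMod p, ∃ x : ℤ × ℤ, f x = true ∧
      ((x.1 : ZMod p), (x.2 : ZMod p)) = c := by
    intro c
    have : c ∈ redSet p {x | f x = true} := by rw [hu]; trivial
    exact this
  choose x hfx hxc using hx
  have hopen : IsOpen (⋂ c, {g : ℤ × ℤ → Bool | g (x c) = true}) := by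
    refine isOpen_iInter_of_finite fun c => ?_
    have hcont : Continuous (fun g : ℤ × ℤ → Bool => g (x c)) := continuous_apply (x c)
    exact (isOpen_discrete ({true} : Set Bool)).preimage hcont
  obtain ⟨g, hg, t, hgt⟩ := mem_closure_iff.1 hf _ hopen (Set.mem_iInter.2 hfx)
  rw [Set.mem_iInter] at hg
  have hv := (hgt _).1 (hg (-(t.1 : ZMod p), -(t.2 : ZMod p)))
  have hc := hxc (-(t.1 : ZMod p), -(t.2 : ZMod p))
  generalize x (-(t.1 : ZMod p), -(t.2 : ZMod p)) = y at hv hc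
  rw [Prod.mk.injEq] at hc
  have d1 : (p : ℤ) ∣ (y + t).1 := by
    rw [← ZMod.intCast_zmod_eq_zero_iff_dvd]; simp [hc.1]
  have d2 : (p : ℤ) ∣ (y + t).2 := by
    rw [← ZMod.intCast_zmod_eq_zero_iff_dvd]; simp [hc.2]
  have hv' : Int.gcd (y + t).1 (y + t).2 = 1 := hv
  have hd' : p ∣ Int.gcd (y + t).1 (y + t).2 := Int.dvd_coe_gcd d1 d2 |> Int.natCast_dvd_natCast.1
  rw [hv'] at hd'
  exact hp.one_lt.ne' (Nat.dvd_one.1 hd')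

theorem zero_mem (Y : Set ((ℤ × ℤ) → Bool)) (hY : Y ⊆ hullV) (hne : Y.Nonempty)
    (hcl : IsClosed Y) (hs : ∀ f ∈ Y, ∀ t : ℤ × ℤ, shift t f ∈ Y) :
    (fun _ => false) ∈ Y := by
  obtain ⟨f, hf⟩ := hne
  choose t ht using exists_hole {x | f x = true} (hull_admissible f (hY hf))
  refine hcl.mem_of_tendsto (b := Filter.atTop) (f := fun F : Finset (ℤ × ℤ) => shift (t F) f)
    ?_ (Filter.Eventually.of_forall fun F => hs f hf _)
  rw [tendsto_pi_nhds]
  intro x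
  refine tendsto_const_nhds.congr' ?_
  filter_upwards [Filter.eventually_ge_atTop {x}] with F hF
  have := ht F x (hF (Finset.mem_singleton_self x))
  exact (Bool.eq_false_of_not_eq_true this).symm

/-- Every admissible subset of `ℤ²` contains holes of arbitrary size; consequently every
element of the hull of `V` contains arbitrarily large holes, and the empty configuration
is the unique minimal subsystem of the hull. -/
theorem admissible_holes_and_unique_minimal_subsystem :
    (∀ A : Set (ℤ × ℤ), (∀ p : ℕ, p.Prime → Set.ncard (redSet p A) < p^2) →
      ∀ ρ : ℝ, 0 < ρ → ∃ t : ℤ × ℤ, ∀ a ∈ A,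
        ¬ (((a.1 : ℝ) - (t.1 : ℝ))^2 + ((a.2 : ℝ) - (t.2 : ℝ))^2 < ρ^2)) ∧
    (∀ f ∈ hullV, ∀ ρ : ℝ, 0 < ρ → ∃ t : ℤ × ℤ, ∀ x : ℤ × ℤ, f x = true →
        ¬ (((x.1 : ℝ) - (t.1 : ℝ))^2 + ((x.2 : ℝ) - (t.2 : ℝ))^2 < ρ^2)) ∧
    (∀ Y : Set ((ℤ × ℤ) → Bool), Y ⊆ hullV → Y.Nonempty → IsClosed Y →
      (∀ f ∈ Y, ∀ t : ℤ × ℤ, shift t f ∈ Y) →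
      (∀ Z : Set ((ℤ × ℤ) → Bool), Z ⊆ Y → Z.Nonempty → IsClosed Z →
        (∀ f ∈ Z, ∀ t : ℤ × ℤ, shift t f ∈ Z) → Z = Y) →
      Y = {fun _ => false}) := by
  refine ⟨exists_ball_hole, ?_, ?_⟩
  · intro f hf ρ hρ
    exact exists_ball_hole {x | f x = true} (hull_admissible f hf) ρ hρ
  · intro Y hY hne hcl hs hmin
    refine (hmin {fun _ => false} ?_ (Set.singleton_nonempty _) isClosed_singleton ?_).symm
    · exact Set.singleton_subset_iff.2 (zero_mem Y hY hne hcl hs)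
    · rintro f rfl t
      rfl
end

section
/- Any ρ-patch P of V occurs with positive frequency: the natural density ν(P) = dens({t ∈ ℤ² : (V − t) ∩ B_ρ(0) = P}) exists, is strictly positive, and is given by ν(P) = Σ_{F ⊆ (ℤ² ∩ B_ρ(0)) \ P} (−1)^{|F|} ∏_p (1 − |(P ∪ F)_p| / p²), where the sum runs over all (finite) subsets F of (ℤ² ∩ B_ρ(0)) \ P and the product over all primes p. -/
open Filter Topology

/-- Reduction of a finite subset of `ℤ²` modulo `m`. -/
def redF (m : ℕ) (P : Finset (ℤ × ℤ)) : Finset (ZMod m × ZMod m) :=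
  P.image fun x => ((x.1 : ZMod m), (x.2 : ZMod m))

def vpDisc (R : ℝ) : Set (ℤ × ℤ) := {t | (t.1 : ℝ)^2 + (t.2 : ℝ)^2 < R^2}

noncomputable def vpCnt (S : Set (ℤ × ℤ)) (R : ℝ) : ℝ := ((S ∩ vpDisc R).ncard : ℝ)

def VpDens (S : Set (ℤ × ℤ)) (d : ℝ) : Prop :=
  Tendsto (fun R : ℝ => vpCnt S R / (Real.pi * R^2)) atTop (𝓝 d)

lemma vpDisc_finite (R : ℝ) : (vpDisc R).Finite := by
  obtain ⟨N, hN⟩ := exists_nat_gt |R|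
  have hNR : R^2 < (N:ℝ)^2 := by
    rw [← sq_abs]; exact pow_lt_pow_left₀ hN (abs_nonneg _) two_ne_zero
  apply Set.Finite.subset ((Set.finite_Icc (-(N:ℤ)) N).prod (Set.finite_Icc (-(N:ℤ)) N))
  rintro ⟨a, b⟩ h
  simp only [vpDisc, Set.mem_ofPred_eq] at h
  have ha : (a:ℝ)^2 < (N:ℝ)^2 := by nlinarith [sq_nonneg (b:ℝ)]
  have hb : (b:ℝ)^2 < (N:ℝ)^2 := by nlinarith [sq_nonneg (a:ℝ)]
  have ha' : a^2 < (N:ℤ)^2 := by exact_mod_cast ha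
  have hb' : b^2 < (N:ℤ)^2 := by exact_mod_cast hb
  have ha2 := abs_lt_of_sq_lt_sq' ha' (by positivity)
  have hb2 := abs_lt_of_sq_lt_sq' hb' (by positivity)
  simp only [Set.mem_prod, Set.mem_Icc]
  omega

lemma vpCnt_univ (x : ℝ) : vpCnt Set.univ x = (vpDisc x).ncard := by simp [vpCnt]

lemma vpCircle : Tendsto (fun R : ℝ => vpCnt Set.univ R / R^2) atTop (𝓝 Real.pi) := by
  set s : Set (Fin 2 → ℝ) := (WithLp.toLp 2) ⁻¹' (Metric.ball (0 : EuclideanSpace ℝ (Fin 2)) 1) with hs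
  have mem_s : ∀ x : Fin 2 → ℝ, x ∈ s ↔ x 0 ^ 2 + x 1 ^ 2 < 1 := by
    intro x
    simp [hs, EuclideanSpace.norm_eq, Real.sqrt_lt' zero_lt_one]
  have hvol : MeasureTheory.volume s = ENNReal.ofReal Real.pi := by
    rw [hs, (PiLp.volume_preserving_toLp (Fin 2)).measure_preimage
      Metric.isOpen_ball.measurableSet.nullMeasurableSet, EuclideanSpace.volume_ball_fin_two]
    simp
  have hopen : IsOpen s := Metric.isOpen_ball.preimage (PiLp.continuous_toLp 2 _)
  have hconv : Convex ℝ s :=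
    (convex_ball (0 : EuclideanSpace ℝ (Fin 2)) 1).linear_preimage
      ((WithLp.linearEquiv 2 ℝ (Fin 2 → ℝ)).symm.toLinearMap)
  have hbdd : Bornology.IsBounded s := by
    rw [isBounded_iff_forall_norm_le]
    refine ⟨1, fun x hx => ?_⟩
    rw [mem_s] at hx
    rw [pi_norm_le_iff_of_nonneg zero_le_one]
    intro i
    rw [Real.norm_eq_abs, ← sq_le_one_iff_abs_le_one]
    fin_cases i
    · show x 0 ^ 2 ≤ 1; nlinarith [sq_nonneg (x 1)]
    · show x 1 ^ 2 ≤ 1; nlinarith [sq_nonneg (x 0)]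
  have key := tendsto_card_div_pow_atTop_volume' s hbdd
    hopen.measurableSet (hconv.addHaar_frontier _) ?_
  · rw [MeasureTheory.measureReal_def, hvol, ENNReal.toReal_ofReal Real.pi_pos.le] at key
    refine key.congr' ?_
    filter_upwards [eventually_gt_atTop 0] with R hR
    simp only [Fintype.card_fin]
    congr 2
    rw [Set.univ_inter]
    rw [← Nat.card_coe_set_eq]
    symm
    have hmem : ∀ t : ℤ × ℤ, t ∈ vpDisc R ↔ R⁻¹ • (![(t.1:ℝ), t.2]) ∈ s := by
      intro t
      rw [mem_s]
      simp only [vpDisc, Set.mem_ofPred_eq, Pi.smul_apply, smul_eq_mul, Matrix.cons_val_zero, Matrix.cons_val_one]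
      rw [mul_pow, mul_pow, ← mul_add, inv_pow, inv_mul_lt_iff₀ (by positivity), mul_one]
    refine Nat.card_congr (Equiv.ofBijective (fun t : vpDisc R => ⟨R⁻¹ • (![(t.1.1:ℝ), t.1.2]), ?_, ?_⟩) ⟨?_, ?_⟩)
    · exact (hmem _).1 t.2
    · refine Set.smul_mem_smul_set ?_
      rw [SetLike.mem_coe, Module.Basis.mem_span_iff_repr_mem]
      intro i
      fin_cases i
      · exact ⟨t.1.1, by simp⟩
      · exact ⟨t.1.2, by simp⟩
    · rintro ⟨⟨a, b⟩, h⟩ ⟨⟨c, d⟩, h'⟩ he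
      have he2 : R⁻¹ • ![(a:ℝ), b] = R⁻¹ • ![(c:ℝ), d] := congrArg Subtype.val he
      have he' := smul_right_injective (Fin 2 → ℝ) (inv_ne_zero hR.ne') he2
      have h0 := congrFun he' 0
      have h1 := congrFun he' 1
      simp at h0 h1
      simp [h0, h1]
    · rintro ⟨x, hx, y, hy, rfl⟩
      rw [SetLike.mem_coe, Module.Basis.mem_span_iff_repr_mem] at hy
      obtain ⟨a, ha⟩ := hy 0
      obtain ⟨b, hb⟩ := hy 1
      simp at ha hb
      have hyy : y = ![(a:ℝ), b] := by
        ext i; fin_cases i <;> simp [ha, hb]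
      refine ⟨⟨(a, b), ?_⟩, ?_⟩
      · rw [hmem]; simpa [← hyy] using hx
      · simp [hyy]
  · rintro x y hx hxy _ ⟨z, hz, rfl⟩
    have hy : 0 < y := hx.trans_le hxy
    refine ⟨(y⁻¹ * x) • z, ?_, ?_⟩
    · rw [mem_s] at hz ⊢
      simp only [Pi.smul_apply, smul_eq_mul, mul_pow]
      have h1 : y⁻¹ * x ≤ 1 := by
        rw [inv_mul_le_iff₀ hy]; simpa using hxy
      have h0 : 0 ≤ y⁻¹ * x := by positivity
      have : (y⁻¹ * x)^2 ≤ 1 := pow_le_one₀ h0 h1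
      rw [← mul_pow, ← mul_add]
      nlinarith [sq_nonneg (z 0), sq_nonneg (z 1)]
    · simp [smul_smul, mul_inv_cancel_left₀ hy.ne']

lemma vp_tri {a b v w r : ℝ} (hr : 0 ≤ r) (h : v^2 + w^2 < r^2) :
    (a + v)^2 + (b + w)^2 < (r + (|a| + |b|))^2 := by
  have hv : |v| ≤ r := abs_le_of_sq_le_sq (by nlinarith [sq_nonneg w]) hr
  have hw : |w| ≤ r := abs_le_of_sq_le_sq (by nlinarith [sq_nonneg v]) hr
  have h1 : a * v ≤ |a| * r := by
    calc a * v ≤ |a * v| := le_abs_self _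
      _ = |a| * |v| := abs_mul _ _
      _ ≤ _ := by gcongr
  have h2 : b * w ≤ |b| * r := by
    calc b * w ≤ |b * w| := le_abs_self _
      _ = |b| * |w| := abs_mul _ _
      _ ≤ _ := by gcongr
  have h3 : a^2 + b^2 ≤ (|a| + |b|)^2 := by
    nlinarith [sq_abs a, sq_abs b, abs_nonneg a, abs_nonneg b, mul_nonneg (abs_nonneg a) (abs_nonneg b)]
  nlinarith

lemma vp_scale (M : ℕ) (hM : 0 < M) (c : ℝ) :
    Tendsto (fun R : ℝ => vpCnt Set.univ ((R + c) / M) / (Real.pi * R^2)) atTop (𝓝 (1 / (M:ℝ)^2)) := by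
  have hM' : (0:ℝ) < M := by exact_mod_cast hM
  have h1 : Tendsto (fun R : ℝ => (R + c) / M) atTop atTop :=
    (tendsto_atTop_add_const_right _ c tendsto_id).atTop_div_const hM'
  have h2 := vpCircle.comp h1
  have h3 : Tendsto (fun R : ℝ => 1 + c * R⁻¹) atTop (𝓝 1) := by
    simpa using (tendsto_inv_atTop_zero.const_mul c).const_add (1:ℝ)
  have h4 := (h2.mul (h3.pow 2)).mul_const (1 / (Real.pi * (M:ℝ)^2))
  have h5 : Real.pi * 1 ^ 2 * (1 / (Real.pi * (M:ℝ)^2)) = 1 / (M:ℝ)^2 := by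
    have := Real.pi_pos.ne'
    field_simp
  rw [h5] at h4
  refine h4.congr' ?_
  filter_upwards [eventually_gt_atTop 0, eventually_gt_atTop (-c)] with R hR hRc
  have : R + c ≠ 0 := by linarith
  have := Real.pi_pos.ne'
  simp only [Function.comp]
  field_simp

lemma vp_coset (M : ℕ) (hM : 0 < M) (a : ℤ × ℤ) :
    VpDens {t | ∃ k : ℤ × ℤ, t = (a.1 + M * k.1, a.2 + M * k.2)} (1 / (M:ℝ)^2) := by
  have hM' : (0:ℝ) < M := by exact_mod_cast hM
  set c : ℝ := |(a.1:ℝ)| + |(a.2:ℝ)| with hc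
  have hc0 : 0 ≤ c := by positivity
  let φ : ℤ × ℤ → ℤ × ℤ := fun k => (a.1 + M * k.1, a.2 + M * k.2)
  have hφ : Function.Injective φ := by
    rintro ⟨x, y⟩ ⟨z, w⟩ h
    have : M ≠ 0 := hM.ne'
    simpa [φ, this] using h
  have hcnt : ∀ R, vpCnt {t | ∃ k : ℤ × ℤ, t = (a.1 + M * k.1, a.2 + M * k.2)} R
      = ((φ ⁻¹' vpDisc R).ncard : ℝ) := by
    intro R
    rw [vpCnt, ← Set.ncard_image_of_injective (φ ⁻¹' vpDisc R) hφ]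
    congr 2
    ext t
    constructor
    · rintro ⟨⟨k, rfl⟩, h⟩
      exact ⟨k, h, rfl⟩
    · rintro ⟨k, h, rfl⟩
      exact ⟨⟨k, rfl⟩, h⟩
  have hfin : ∀ R, (φ ⁻¹' vpDisc R).Finite := fun R => (vpDisc_finite R).preimage hφ.injOn
  refine tendsto_of_tendsto_of_tendsto_of_le_of_le' (vp_scale M hM (-c)) (vp_scale M hM c) ?_ ?_
  · filter_upwards [eventually_gt_atTop c] with R hR
    gcongr
    rw [hcnt, vpCnt_univ]
    norm_cast
    refine Set.ncard_le_ncard ?_ (hfin R)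
    intro k hk
    simp only [vpDisc, Set.mem_ofPred_eq, Set.mem_preimage, φ] at hk ⊢
    have := vp_tri (a := a.1) (b := a.2) (v := M * k.1) (w := M * k.2) (r := R + -c) (by linarith) (by
      rw [div_pow, lt_div_iff₀ (by positivity)] at hk
      nlinarith)
    rw [← hc] at this
    push_cast
    convert this using 2
    ring
  · filter_upwards [eventually_gt_atTop c] with R hR
    gcongr
    rw [hcnt, vpCnt_univ]
    norm_cast
    refine Set.ncard_le_ncard ?_ (vpDisc_finite _)
    intro k hk
    simp only [vpDisc, Set.mem_ofPred_eq, Set.mem_preimage, φ] at hk ⊢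
    push_cast at hk
    have := vp_tri (a := -a.1) (b := -a.2) (r := R) (by linarith) hk
    rw [abs_neg, abs_neg, ← hc] at this
    rw [div_pow, lt_div_iff₀ (by positivity)]
    refine lt_of_eq_of_lt ?_ this
    ring

lemma vpCnt_iUnion {ι : Type*} (s : Finset ι) (S : ι → Set (ℤ × ℤ))
    (hd : ∀ i ∈ s, ∀ j ∈ s, i ≠ j → Disjoint (S i) (S j)) (R : ℝ) :
    vpCnt (⋃ i ∈ s, S i) R = ∑ i ∈ s, vpCnt (S i) R := by
  classical
  induction s using Finset.induction_on with
  | empty => simp [vpCnt]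
  | insert a s ha ih =>
    rw [Finset.sum_insert ha, ← ih fun i hi j hj => hd i (by simp [hi]) j (by simp [hj])]
    rw [Finset.set_biUnion_insert, vpCnt, Set.union_inter_distrib_right, Set.ncard_union_eq ?_ ((vpDisc_finite R).inter_of_right _) ((vpDisc_finite R).inter_of_right _)]
    · push_cast; rfl
    · refine Disjoint.mono Set.inter_subset_left Set.inter_subset_left ?_
      rw [Set.disjoint_iUnion₂_right]
      intro i hi
      exact hd a (by simp) i (by simp [hi]) (by rintro rfl; exact ha hi)

lemma vp_periodic (M : ℕ) (hM : 0 < M) (B : Finset (ZMod M × ZMod M)) :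
    VpDens {t | ((t.1 : ZMod M), (t.2 : ZMod M)) ∈ B} ((B.card : ℝ) / (M:ℝ)^2) := by
  have h1 : {t : ℤ × ℤ | ((t.1 : ZMod M), (t.2 : ZMod M)) ∈ B} =
      ⋃ b ∈ B, {t : ℤ × ℤ | ((t.1 : ZMod M), (t.2 : ZMod M)) = b} := by
    ext t; simp
  have h2 : ∀ b : ZMod M × ZMod M, VpDens {t : ℤ × ℤ | ((t.1 : ZMod M), (t.2 : ZMod M)) = b} (1 / (M:ℝ)^2) := by
    rintro ⟨b1, b2⟩
    obtain ⟨x, rfl⟩ := ZMod.intCast_surjective b1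
    obtain ⟨y, rfl⟩ := ZMod.intCast_surjective b2
    convert vp_coset M hM (x, y) using 1
    ext ⟨u, v⟩
    simp only [Set.mem_ofPred_eq, Prod.mk.injEq, Prod.exists, eq_comm (b := (x : ZMod M)), eq_comm (b := (y : ZMod M)),
      ZMod.intCast_eq_intCast_iff_dvd_sub]
    constructor
    · rintro ⟨⟨k, hk⟩, ⟨l, hl⟩⟩
      exact ⟨k, l, by linarith, by linarith⟩
    · rintro ⟨k, l, hk, hl⟩
      exact ⟨⟨k, by linarith⟩, ⟨l, by linarith⟩⟩
  unfold VpDens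
  have h3 := tendsto_finsetSum B fun b _ => h2 b
  simp only [Finset.sum_const, nsmul_eq_mul, mul_one_div] at h3
  refine h3.congr fun R => ?_
  rw [h1, vpCnt_iUnion, Finset.sum_div]
  intro i _ j _ hij
  rw [Set.disjoint_left]
  rintro t rfl h
  exact hij h

lemma vp_crt (B : (p : Nat.Primes) → Finset (ZMod p × ZMod p)) (T : Finset Nat.Primes) :
    ∃ M : ℕ, M = ∏ p ∈ T, (p : ℕ) ∧ ∃ C : Finset (ZMod M × ZMod M), C.card = ∏ p ∈ T, (B p).card ∧
      ∀ t : ℤ × ℤ, ((t.1 : ZMod M), (t.2 : ZMod M)) ∈ C ↔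
        ∀ p ∈ T, ((t.1 : ZMod p), (t.2 : ZMod p)) ∈ B p := by
  classical
  induction T using Finset.induction_on with
  | empty => exact ⟨1, by simp, Finset.univ, by simp, by simp⟩
  | insert p T hp ih =>
    obtain ⟨M, hM, C, hC, hmem⟩ := ih
    have hco : (p : ℕ).Coprime M := by
      rw [hM]
      refine Nat.Coprime.prod_right fun q hq => ?_
      rw [Nat.coprime_primes p.2 q.2]
      intro h
      exact hp (by rwa [show p = q from Subtype.ext h])
    let e := ZMod.chineseRemainder hco
    let E : (ZMod (p * M) × ZMod (p * M)) ≃ (ZMod p × ZMod p) × (ZMod M × ZMod M) :=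
      (Equiv.prodCongr e.toEquiv e.toEquiv).trans (Equiv.prodProdProdComm _ _ _ _)
    refine ⟨p * M, by rw [Finset.prod_insert hp, hM], ((B p) ×ˢ C).map E.symm.toEmbedding, ?_, ?_⟩
    · rw [Finset.card_map, Finset.card_product, hC, Finset.prod_insert hp]
    · intro t
      rw [Finset.mem_map_equiv, Equiv.symm_symm, Finset.forall_mem_insert, ← hmem]
      have : E ((t.1 : ZMod (p * M)), (t.2 : ZMod (p * M))) =
        (((t.1 : ZMod p), (t.2 : ZMod p)), ((t.1 : ZMod M), (t.2 : ZMod M))) := by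
        simp [E]
      rw [this, Finset.mem_product]

lemma vp_finite_primes (B : (p : Nat.Primes) → Finset (ZMod p × ZMod p)) (T : Finset Nat.Primes) :
    VpDens {t | ∀ p ∈ T, ((t.1 : ZMod p), (t.2 : ZMod p)) ∈ B p}
      (∏ p ∈ T, ((B p).card : ℝ) / ((p : ℕ) : ℝ)^2) := by
  obtain ⟨M, hM, C, hC, hmem⟩ := vp_crt B T
  have hM0 : 0 < M := by
    rw [hM]; exact Finset.prod_pos fun p _ => p.2.pos
  have := vp_periodic M hM0 C
  simp only [hmem] at this
  convert this using 1
  rw [Finset.prod_div_distrib, hC, Finset.prod_pow, hM]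
  push_cast
  rfl

noncomputable def vpBox (N : ℕ) : Finset (ℤ × ℤ) :=
  Finset.Icc (-(N:ℤ)) N ×ˢ Finset.Icc (-(N:ℤ)) N

lemma vp_box_count (N n : ℕ) (hn : 0 < n) :
    (((vpBox N).filter fun z => z ≠ 0 ∧ (n:ℤ) ∣ z.1 ∧ (n:ℤ) ∣ z.2).card : ℝ)
      ≤ 8 * (N:ℝ)^2 * ((n:ℝ)^2)⁻¹ := by
  set q := N / n with hq
  have hsub : ((vpBox N).filter fun z => z ≠ 0 ∧ (n:ℤ) ∣ z.1 ∧ (n:ℤ) ∣ z.2) ⊆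
      ((vpBox q).erase 0).image fun z => (n * z.1, n * z.2) := by
    rintro ⟨a, b⟩ h
    simp only [vpBox, Finset.mem_filter, Finset.mem_product, Finset.mem_Icc] at h
    obtain ⟨⟨⟨h1, h2⟩, h3, h4⟩, h5, ⟨k, rfl⟩, ⟨l, rfl⟩⟩ := h
    have hn' : (0:ℤ) < n := by exact_mod_cast hn
    have hqz : (q:ℤ) = (N:ℤ) / n := by rw [hq]; push_cast; rfl
    have hb : ∀ k : ℤ, -(N:ℤ) ≤ n * k → n * k ≤ N → -(q:ℤ) ≤ k ∧ k ≤ q := by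
      intro k h1 h2
      rw [hqz]
      constructor
      · have : -k ≤ (N:ℤ) / n := by
          rw [Int.le_ediv_iff_mul_le hn']; linarith
        linarith
      · rw [Int.le_ediv_iff_mul_le hn']; linarith
    refine Finset.mem_image.2 ⟨(k, l), ?_, rfl⟩
    simp only [vpBox, Finset.mem_erase, Finset.mem_product, Finset.mem_Icc]
    refine ⟨?_, hb k h1 h2, hb l h3 h4⟩
    intro h0
    apply h5
    simp only [Prod.mk_eq_zero] at h0
    simp [h0.1, h0.2]
  have hcard : ((vpBox q).erase 0).card = (2 * q + 1) ^ 2 - 1 := by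
    rw [Finset.card_erase_of_mem (by simp [vpBox]), vpBox, Finset.card_product, Int.card_Icc]
    have : ((q:ℤ) + 1 - -(q:ℤ)).toNat = 2 * q + 1 := by omega
    rw [this]; ring_nf
  have h1 : ((vpBox N).filter fun z => z ≠ 0 ∧ (n:ℤ) ∣ z.1 ∧ (n:ℤ) ∣ z.2).card ≤ 8 * q ^ 2 := by
    refine (Finset.card_le_card hsub).trans (Finset.card_image_le.trans ?_)
    rw [hcard]
    rw [Nat.sub_le_iff_le_add]
    nlinarith [Nat.le_self_pow two_ne_zero q]
  have hq2 : (q:ℝ) ≤ N / n := Nat.cast_div_le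
  calc _ ≤ ((8 * q ^ 2 : ℕ) : ℝ) := by exact_mod_cast h1
    _ = 8 * (q:ℝ)^2 := by push_cast; ring
    _ ≤ 8 * ((N:ℝ)/n)^2 := by gcongr
    _ = _ := by rw [div_pow]; ring

def vpTail (y : ℤ × ℤ) (K : ℕ) : Set (ℤ × ℤ) :=
  {t | ∃ n : ℕ, K < n ∧ (n:ℤ) ∣ (y + t).1 ∧ (n:ℤ) ∣ (y + t).2}

open Classical in
lemma vp_box_tail (N K : ℕ) (hK : 0 < K) :
    (((vpBox N).filter fun z : ℤ × ℤ => ∃ n : ℕ, K < n ∧ (n:ℤ) ∣ z.1 ∧ (n:ℤ) ∣ z.2).card : ℝ)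
      ≤ 1 + 8 * (N:ℝ)^2 / K := by
  classical
  have hsub : ((vpBox N).filter fun z : ℤ × ℤ => ∃ n : ℕ, K < n ∧ (n:ℤ) ∣ z.1 ∧ (n:ℤ) ∣ z.2) ⊆
      {0} ∪ (Finset.Ioc K N).biUnion fun n =>
        (vpBox N).filter fun z => z ≠ 0 ∧ (n:ℤ) ∣ z.1 ∧ (n:ℤ) ∣ z.2 := by
    intro z hz
    obtain ⟨hz, n, hn, h1, h2⟩ := Finset.mem_filter.1 hz
    by_cases h0 : z = 0
    · simp [h0]
    refine Finset.mem_union_right _ (Finset.mem_biUnion.2 ⟨n, ?_, Finset.mem_filter.2 ⟨hz, h0, h1, h2⟩⟩)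
    rw [Finset.mem_Ioc]
    refine ⟨hn, ?_⟩
    simp only [vpBox, Finset.mem_product, Finset.mem_Icc] at hz
    by_contra hN
    push Not at hN
    apply h0
    have e1 := Int.eq_zero_of_abs_lt_dvd h1 (by rw [abs_lt]; omega)
    have e2 := Int.eq_zero_of_abs_lt_dvd h2 (by rw [abs_lt]; omega)
    exact Prod.ext e1 e2
  have h1 := (Finset.card_le_card hsub).trans (Finset.card_union_le _ _)
  have h2 : (((Finset.Ioc K N).biUnion fun n =>
        (vpBox N).filter fun z => z ≠ 0 ∧ (n:ℤ) ∣ z.1 ∧ (n:ℤ) ∣ z.2).card : ℝ) ≤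
      8 * (N:ℝ)^2 / K := by
    calc _ ≤ ((∑ n ∈ Finset.Ioc K N, ((vpBox N).filter fun z => z ≠ 0 ∧ (n:ℤ) ∣ z.1 ∧ (n:ℤ) ∣ z.2).card : ℕ) : ℝ) := by
          exact_mod_cast Finset.card_biUnion_le
      _ ≤ ∑ n ∈ Finset.Ioc K N, 8 * (N:ℝ)^2 * ((n:ℝ)^2)⁻¹ := by
          push_cast
          refine Finset.sum_le_sum fun n hn => vp_box_count N n ?_
          exact (Nat.zero_le _).trans_lt (Finset.mem_Ioc.1 hn).1
      _ = 8 * (N:ℝ)^2 * ∑ n ∈ Finset.Ioc K N, ((n:ℝ)^2)⁻¹ := by rw [Finset.mul_sum]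
      _ ≤ 8 * (N:ℝ)^2 * (K:ℝ)⁻¹ := by
          gcongr
          rcases le_total K N with h | h
          · refine (sum_Ioc_inv_sq_le_sub hK.ne' h).trans ?_
            have : (0:ℝ) ≤ (N:ℝ)⁻¹ := by positivity
            linarith
          · rw [Finset.Ioc_eq_empty (by omega)]
            simp
      _ = _ := by ring
  have h3 : (((vpBox N).filter fun z : ℤ × ℤ => ∃ n : ℕ, K < n ∧ (n:ℤ) ∣ z.1 ∧ (n:ℤ) ∣ z.2).card : ℝ) ≤
      ((({0} : Finset (ℤ × ℤ)).card + ((Finset.Ioc K N).biUnion fun n =>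
        (vpBox N).filter fun z => z ≠ 0 ∧ (n:ℤ) ∣ z.1 ∧ (n:ℤ) ∣ z.2).card : ℕ) : ℝ) := by
    exact_mod_cast h1
  push_cast at h3
  simp only [Finset.card_singleton, Nat.cast_one] at h3
  linarith

open Classical in
lemma vp_tail (y : ℤ × ℤ) (K : ℕ) (hK : 0 < K) :
    ∀ᶠ R : ℝ in atTop, vpCnt (vpTail y K) R ≤ 33 * R^2 / K := by
  set c : ℕ := y.1.natAbs + y.2.natAbs with hc
  filter_upwards [eventually_gt_atTop ((c:ℝ) + 1), eventually_gt_atTop (K:ℝ)] with R hR hRK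
  have hK' : (1:ℝ) ≤ K := by exact_mod_cast hK
  have hR0 : 0 < R := by linarith
  set N := ⌈R⌉₊ + c with hN
  have hNR : (N:ℝ) ≤ 2 * R := by
    have := Nat.ceil_lt_add_one hR0.le
    rw [hN]; push_cast; linarith
  have hRc := Nat.le_ceil R
  have h1 : vpCnt (vpTail y K) R ≤
      (((vpBox N).filter fun z : ℤ × ℤ => ∃ n : ℕ, K < n ∧ (n:ℤ) ∣ z.1 ∧ (n:ℤ) ∣ z.2).card : ℝ) := by
    rw [vpCnt]
    norm_cast
    rw [← Set.ncard_coe_finset]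
    refine Set.ncard_le_ncard_of_injOn (fun t => y + t) ?_ (fun a _ b _ h => by simpa using h)
      (Finset.finite_toSet _)
    rintro ⟨a, b⟩ ⟨ht, hd⟩
    rw [Finset.mem_coe, Finset.mem_filter]
    refine ⟨?_, ht⟩
    simp only [vpDisc, Set.mem_ofPred_eq] at hd
    have ha := abs_lt_of_sq_lt_sq' (a := (a:ℝ)) (b := R) (by nlinarith [sq_nonneg (b:ℝ)]) hR0.le
    have hb := abs_lt_of_sq_lt_sq' (a := (b:ℝ)) (b := R) (by nlinarith [sq_nonneg (a:ℝ)]) hR0.le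
    have ha1 : a ≤ (⌈R⌉₊ : ℤ) := by have : (a:ℝ) ≤ (⌈R⌉₊ : ℝ) := by linarith
                                    exact_mod_cast this
    have ha2 : -(⌈R⌉₊ : ℤ) ≤ a := by have : -(⌈R⌉₊ : ℝ) ≤ (a:ℝ) := by linarith
                                     exact_mod_cast this
    have hb1 : b ≤ (⌈R⌉₊ : ℤ) := by have : (b:ℝ) ≤ (⌈R⌉₊ : ℝ) := by linarith
                                    exact_mod_cast this
    have hb2 : -(⌈R⌉₊ : ℤ) ≤ b := by have : -(⌈R⌉₊ : ℝ) ≤ (b:ℝ) := by linarith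
                                     exact_mod_cast this
    simp only [vpBox, Finset.mem_product, Finset.mem_Icc, Prod.fst_add, Prod.snd_add]
    omega
  have h2 := vp_box_tail N K hK
  have h3 : 8 * (N:ℝ)^2 / K ≤ 8 * (2 * R)^2 / K := by gcongr
  have h4 : 1 ≤ R^2 / K := by
    rw [le_div_iff₀ (by linarith)]; nlinarith
  calc _ ≤ R^2 / K + 8 * (2 * R)^2 / K := by linarith
    _ = _ := by ring

lemma vp_tprod {ι : Type*} (f : ι → ℝ) (h0 : ∀ i, 0 ≤ f i) (h1 : ∀ i, f i ≤ 1) :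
    Tendsto (fun s : Finset ι => ∏ i ∈ s, f i) atTop (𝓝 (∏' i, f i)) := by
  classical
  have hanti : Antitone fun s : Finset ι => ∏ i ∈ s, f i := by
    intro s t hst
    show ∏ i ∈ t, f i ≤ ∏ i ∈ s, f i
    rw [← Finset.prod_sdiff hst]
    exact mul_le_of_le_one_left (Finset.prod_nonneg fun i _ => h0 i)
      (Finset.prod_le_one (fun i _ => h0 i) (fun i _ => h1 i))
  have hb : BddBelow (Set.range fun s : Finset ι => ∏ i ∈ s, f i) :=
    ⟨0, by rintro _ ⟨s, rfl⟩; exact Finset.prod_nonneg fun i _ => h0 i⟩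
  have hp : HasProd f (⨅ s : Finset ι, ∏ i ∈ s, f i) := by
    simpa [HasProd] using tendsto_atTop_ciInf hanti hb
  rw [hp.tprod_eq]
  exact tendsto_atTop_ciInf hanti hb

lemma vpCnt_mono {S T : Set (ℤ × ℤ)} (h : S ⊆ T) (R : ℝ) : vpCnt S R ≤ vpCnt T R := by
  unfold vpCnt
  norm_cast
  exact Set.ncard_le_ncard (Set.inter_subset_inter_left _ h) ((vpDisc_finite R).inter_of_right _)

lemma vpCnt_union (S T : Set (ℤ × ℤ)) (R : ℝ) : vpCnt (S ∪ T) R ≤ vpCnt S R + vpCnt T R := by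
  unfold vpCnt
  norm_cast
  rw [Set.union_inter_distrib_right]
  exact Set.ncard_union_le _ _

lemma vpCnt_biUnion_le {ι : Type*} (s : Finset ι) (S : ι → Set (ℤ × ℤ)) (R : ℝ) :
    vpCnt (⋃ i ∈ s, S i) R ≤ ∑ i ∈ s, vpCnt (S i) R := by
  classical
  induction s using Finset.induction_on with
  | empty => simp [vpCnt]
  | insert a s ha ih =>
    rw [Finset.sum_insert ha, Finset.set_biUnion_insert]
    exact (vpCnt_union _ _ R).trans (by linarith)

lemma vp_card_le_one (p : Nat.Primes) (B : Finset (ZMod p × ZMod p)) :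
    (B.card : ℝ) / ((p : ℕ) : ℝ)^2 ≤ 1 := by
  have hp : (0:ℝ) < (p : ℕ) := by exact_mod_cast p.2.pos
  have : NeZero (p : ℕ) := ⟨p.2.ne_zero⟩
  rw [div_le_one (by positivity)]
  have := Finset.card_le_univ B
  rw [Fintype.card_prod, ZMod.card, ← sq] at this
  exact_mod_cast this

lemma vp_primes_le_finite (K : ℕ) : {p : Nat.Primes | (p : ℕ) ≤ K}.Finite :=
  (Set.finite_Iic K).preimage Nat.Primes.coe_nat_injective.injOn

lemma vp_sieve (B : (p : Nat.Primes) → Finset (ZMod p × ZMod p)) (Q : Finset (ℤ × ℤ)) (K0 : ℕ)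
    (h : ∀ p : Nat.Primes, K0 < (p : ℕ) → ∀ t : ℤ × ℤ, ((t.1 : ZMod p), (t.2 : ZMod p)) ∉ B p →
      ∃ y ∈ Q, ((p : ℕ) : ℤ) ∣ (y + t).1 ∧ ((p : ℕ) : ℤ) ∣ (y + t).2) :
    VpDens {t | ∀ p : Nat.Primes, ((t.1 : ZMod p), (t.2 : ZMod p)) ∈ B p}
      (∏' p : Nat.Primes, ((B p).card : ℝ) / ((p : ℕ) : ℝ)^2) := by
  set d := ∏' p : Nat.Primes, ((B p).card : ℝ) / ((p : ℕ) : ℝ)^2 with hd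
  have hT := vp_tprod (fun p : Nat.Primes => ((B p).card : ℝ) / ((p : ℕ) : ℝ)^2)
    (fun p => by positivity) (fun p => vp_card_le_one p _)
  rw [← hd] at hT
  unfold VpDens
  rw [Metric.tendsto_nhds]
  intro ε hε
  obtain ⟨K1, hK1⟩ := exists_nat_gt (33 * Q.card / (ε / 3))
  set K := K0 + K1 + 1 with hKdef
  have hK0 : 0 < K := by omega
  have hKr : (0:ℝ) < K := by exact_mod_cast hK0
  have hKε : 33 * (Q.card : ℝ) / K < ε / 3 := by
    rw [div_lt_iff₀ (by positivity)] at hK1 ⊢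
    have : (K1:ℝ) ≤ K := by rw [hKdef]; push_cast; linarith [(Nat.cast_nonneg K0 : (0:ℝ) ≤ K0)]
    nlinarith
  obtain ⟨T, hT1, hT2⟩ := ((Metric.tendsto_nhds.1 hT (ε / 3) (by positivity)).and
    (eventually_ge_atTop (vp_primes_le_finite K).toFinset)).exists
  have htail : ∀ᶠ R : ℝ in atTop, ∀ y ∈ Q, vpCnt (vpTail y K) R ≤ 33 * R^2 / K :=
    (Filter.eventually_all_finset Q).2 fun y _ => vp_tail y K hK0
  filter_upwards [htail, Metric.tendsto_nhds.1 (vp_finite_primes B T) (ε / 3) (by positivity),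
    eventually_gt_atTop 0] with R hR1 hR2 hR0
  set X : Set (ℤ × ℤ) := {t | ∀ p : Nat.Primes, ((t.1 : ZMod p), (t.2 : ZMod p)) ∈ B p} with hX
  set Y : Set (ℤ × ℤ) := {t | ∀ p ∈ T, ((t.1 : ZMod p), (t.2 : ZMod p)) ∈ B p} with hY
  have hXY : X ⊆ Y := fun t ht p _ => ht p
  have hYX : Y ⊆ X ∪ ⋃ y ∈ Q, vpTail y K := by
    intro t ht
    by_cases hx : t ∈ X
    · exact Or.inl hx
    right
    simp only [hX, Set.mem_ofPred_eq, not_forall] at hx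
    obtain ⟨p, hp⟩ := hx
    have hpK : K < (p : ℕ) := by
      by_contra hle
      push Not at hle
      exact hp (ht p (hT2 (by simpa using hle)))
    obtain ⟨y, hy, hd⟩ := h p (by omega) t hp
    exact Set.mem_iUnion₂.2 ⟨y, hy, p, hpK, hd⟩
  have h1 := vpCnt_mono hXY R
  have h2 : vpCnt Y R ≤ vpCnt X R + Q.card * (33 * R^2 / K) := by
    refine (vpCnt_mono hYX R).trans ((vpCnt_union _ _ R).trans ?_)
    gcongr
    refine (vpCnt_biUnion_le _ _ R).trans ?_
    rw [← nsmul_eq_mul]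
    exact Finset.sum_le_card_nsmul _ _ _ hR1
  have hpi : 1 < Real.pi := by linarith [Real.pi_gt_three]
  have hden : 0 < Real.pi * R^2 := by positivity
  have h3 : vpCnt Y R / (Real.pi * R^2) ≤ vpCnt X R / (Real.pi * R^2) + ε / 3 := by
    rw [div_add' _ _ _ hden.ne']
    gcongr
    refine h2.trans ?_
    refine add_le_add le_rfl ?_
    calc (Q.card : ℝ) * (33 * R^2 / K) = (33 * Q.card / K) * R^2 := by ring
      _ ≤ ε / 3 * R^2 := by gcongr
      _ ≤ ε / 3 * (Real.pi * R^2) := by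
        gcongr
        nlinarith [sq_nonneg R]
  have h4 : vpCnt X R / (Real.pi * R^2) ≤ vpCnt Y R / (Real.pi * R^2) := by gcongr
  rw [Real.dist_eq, abs_lt] at hR2 hT1 ⊢
  constructor <;> linarith [hR2.1, hR2.2, hT1.1, hT1.2]

lemma vp_vis_iff (x : ℤ × ℤ) :
    x ∈ Vis ↔ ∀ p : Nat.Primes, ¬ (((p : ℕ) : ℤ) ∣ x.1 ∧ ((p : ℕ) : ℤ) ∣ x.2) := by
  simp only [Vis, Set.mem_ofPred_eq, Nat.eq_one_iff_not_exists_prime_dvd]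
  constructor
  · intro h p hp
    exact h p p.2 (by exact_mod_cast Int.dvd_coe_gcd hp.1 hp.2)
  · intro h p hp hd
    have hd' : (p : ℤ) ∣ (Int.gcd x.1 x.2 : ℤ) := by exact_mod_cast hd
    exact h ⟨p, hp⟩ ⟨hd'.trans (Int.gcd_dvd_left ..), hd'.trans (Int.gcd_dvd_right ..)⟩

/-- Residues mod `p` not congruent to the negative of an element of `Q`. -/
noncomputable def vpB (Q : Finset (ℤ × ℤ)) (p : Nat.Primes) : Finset (ZMod p × ZMod p) :=
  haveI : NeZero (p : ℕ) := ⟨p.2.ne_zero⟩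
  Finset.univ \ (redF p Q).map (Equiv.neg _).toEmbedding

lemma vpB_mem (Q : Finset (ℤ × ℤ)) (p : Nat.Primes) (t : ℤ × ℤ) :
    ((t.1 : ZMod p), (t.2 : ZMod p)) ∈ vpB Q p ↔
      ∀ y ∈ Q, ¬ (((p : ℕ) : ℤ) ∣ (y + t).1 ∧ ((p : ℕ) : ℤ) ∣ (y + t).2) := by
  have : NeZero (p : ℕ) := ⟨p.2.ne_zero⟩
  rw [vpB, Finset.mem_sdiff, Finset.mem_map_equiv, redF, Finset.mem_image]
  simp only [Finset.mem_univ, true_and, not_exists, not_and']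
  refine forall_congr' fun y => ?_
  rw [← ZMod.intCast_zmod_eq_zero_iff_dvd, ← ZMod.intCast_zmod_eq_zero_iff_dvd]
  simp only [Equiv.neg_symm, Equiv.neg_apply, Prod.neg_mk, Prod.mk.injEq, Prod.fst_add, Prod.snd_add,
    Int.cast_add, eq_neg_iff_add_eq_zero]
  tauto

lemma vpB_card (Q : Finset (ℤ × ℤ)) (p : Nat.Primes) :
    ((vpB Q p).card : ℝ) / ((p : ℕ) : ℝ)^2 = 1 - ((redF (p : ℕ) Q).card : ℝ) / ((p : ℕ) : ℝ)^2 := by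
  have hp : (0:ℝ) < (p : ℕ) := by exact_mod_cast p.2.pos
  have : NeZero (p : ℕ) := ⟨p.2.ne_zero⟩
  rw [vpB, Finset.card_sdiff_of_subset (Finset.subset_univ _), Finset.card_map,
    Finset.card_univ, Fintype.card_prod, ZMod.card]
  have hle := Finset.card_le_univ (redF (p : ℕ) Q)
  rw [Fintype.card_prod, ZMod.card] at hle
  rw [Nat.cast_sub hle]
  push_cast
  field_simp

lemma vp_visible_dens (Q : Finset (ℤ × ℤ)) :
    VpDens {t | ∀ y ∈ Q, y + t ∈ Vis}
      (∏' p : Nat.Primes, (1 - ((redF (p : ℕ) Q).card : ℝ) / ((p : ℕ) : ℝ)^2)) := by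
  have := vp_sieve (vpB Q) Q 0 (fun p _ t ht => by
    rw [vpB_mem] at ht
    push Not at ht
    exact ht)
  simp only [vpB_card, vpB_mem] at this
  convert this using 2
  ext t
  simp only [vp_vis_iff]
  exact ⟨fun h p y hy => h y hy p, fun h y hy p => h p y hy⟩

lemma vp_weierstrass {ι : Type*} (s : Finset ι) (a : ι → ℝ) (h0 : ∀ i ∈ s, 0 ≤ a i)
    (h1 : ∀ i ∈ s, a i ≤ 1) : 1 - ∑ i ∈ s, a i ≤ ∏ i ∈ s, (1 - a i) := by
  classical
  induction s using Finset.induction_on with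
  | empty => simp
  | insert b s hb ih =>
    rw [Finset.sum_insert hb, Finset.prod_insert hb]
    have i1 := ih (fun i hi => h0 i (by simp [hi])) (fun i hi => h1 i (by simp [hi]))
    have hb0 := h0 b (by simp)
    have hb1 := h1 b (by simp)
    have hs : 0 ≤ ∑ i ∈ s, a i := Finset.sum_nonneg fun i hi => h0 i (by simp [hi])
    nlinarith [mul_le_mul_of_nonneg_left i1 (sub_nonneg.2 hb1), mul_nonneg hb0 hs]

lemma vp_prime_tail (T : Finset Nat.Primes) (K : ℕ) (hK : 0 < K) (hT : ∀ p ∈ T, K < (p : ℕ)) :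
    ∑ p ∈ T, (((p : ℕ) : ℝ)^2)⁻¹ ≤ (K:ℝ)⁻¹ := by
  obtain ⟨N, hN⟩ : ∃ N : ℕ, ∀ p ∈ T, (p : ℕ) ≤ N := ⟨T.sup (fun p => (p : ℕ)), fun p hp => Finset.le_sup (f := fun p : Nat.Primes => (p : ℕ)) hp⟩
  calc ∑ p ∈ T, (((p : ℕ) : ℝ)^2)⁻¹ = ∑ n ∈ T.image (fun p : Nat.Primes => (p : ℕ)), ((n : ℝ)^2)⁻¹ := by
        exact (Finset.sum_image (f := fun n : ℕ => ((n : ℝ)^2)⁻¹)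
          (fun a _ b _ h => Nat.Primes.coe_nat_injective h)).symm
    _ ≤ ∑ n ∈ Finset.Ioc K (N + K), ((n : ℝ)^2)⁻¹ := by
        refine Finset.sum_le_sum_of_subset_of_nonneg ?_ (fun _ _ _ => by positivity)
        intro n hn
        obtain ⟨p, hp, rfl⟩ := Finset.mem_image.1 hn
        rw [Finset.mem_Ioc]
        exact ⟨hT p hp, (hN p hp).trans (Nat.le_add_right _ _)⟩
    _ ≤ (K:ℝ)⁻¹ - ((N + K : ℕ):ℝ)⁻¹ := sum_Ioc_inv_sq_le_sub hK.ne' (by omega)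
    _ ≤ _ := by
        have : (0:ℝ) ≤ ((N + K : ℕ):ℝ)⁻¹ := by positivity
        linarith

lemma vp_red_card_le (Q : Finset (ℤ × ℤ)) (m : ℕ) : (redF m Q).card ≤ Q.card :=
  Finset.card_image_le

lemma vp_pos_dens (P D : Finset (ℤ × ℤ)) (t0 : ℤ × ℤ) (h1 : ∀ y ∈ P, y + t0 ∈ Vis)
    (h2 : ∀ y ∈ D, y ∉ P → y + t0 ∉ Vis) :
    ∃ (X : Set (ℤ × ℤ)) (d : ℝ), 0 < d ∧ VpDens X d ∧
      ∀ t ∈ X, (∀ y ∈ P, y + t ∈ Vis) ∧ (∀ y ∈ D, y ∉ P → y + t ∉ Vis) := by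
  classical
  have hex : ∀ y : ℤ × ℤ, ∃ q : Nat.Primes, y ∈ D → y ∉ P →
      ((q : ℕ) : ℤ) ∣ (y + t0).1 ∧ ((q : ℕ) : ℤ) ∣ (y + t0).2 := by
    intro y
    by_cases hy : y ∈ D ∧ y ∉ P
    · have := h2 y hy.1 hy.2
      rw [vp_vis_iff] at this
      push Not at this
      obtain ⟨q, hq⟩ := this
      exact ⟨q, fun _ _ => hq⟩
    · exact ⟨⟨2, Nat.prime_two⟩, fun h h' => absurd ⟨h, h'⟩ hy⟩
  choose q hq using hex
  set K : ℕ := D.sup (fun y => (q y : ℕ)) + 2 * P.card + 1 with hK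
  have hqK : ∀ y ∈ D, (q y : ℕ) ≤ K := fun y hy =>
    (Finset.le_sup (f := fun y => (q y : ℕ)) hy).trans (by omega)
  have hK0 : 0 < K := by omega
  have hKP : 2 * P.card ≤ K := by omega
  clear_value K
  let B : (p : Nat.Primes) → Finset (ZMod p × ZMod p) := fun p =>
    if (p : ℕ) ≤ K then {((t0.1 : ZMod p), (t0.2 : ZMod p))} else vpB P p
  have hBs : ∀ p : Nat.Primes, (p : ℕ) ≤ K → B p = {((t0.1 : ZMod p), (t0.2 : ZMod p))} :=
    fun p hp => if_pos hp
  have hBl : ∀ p : Nat.Primes, K < (p : ℕ) → B p = vpB P p := fun p hp => if_neg (by omega)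
  clear_value B
  refine ⟨_, _, ?_, vp_sieve B P K ?_, ?_⟩
  · set S := (vp_primes_le_finite K).toFinset with hS
    have hT := vp_tprod (fun p : Nat.Primes => ((B p).card : ℝ) / ((p : ℕ) : ℝ)^2)
      (fun p => by positivity) (fun p => vp_card_le_one p _)
    set c : ℝ := ∏ p ∈ S, ((B p).card : ℝ) / ((p : ℕ) : ℝ)^2 with hc
    have hcpos : 0 < c := by
      refine Finset.prod_pos fun p hp => ?_
      have hp' : (p : ℕ) ≤ K := by simpa [hS] using hp
      rw [hBs p hp', Finset.card_singleton]
      have : (0:ℝ) < (p : ℕ) := by exact_mod_cast p.2.pos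
      positivity
    suffices hge : c / 2 ≤ ∏' p : Nat.Primes, ((B p).card : ℝ) / ((p : ℕ) : ℝ)^2 by linarith
    refine ge_of_tendsto hT ?_
    filter_upwards [eventually_ge_atTop S] with T hST
    rw [← Finset.prod_sdiff hST, ← hc]
    have hbig : ∀ p ∈ T \ S, K < (p : ℕ) := by
      intro p hp
      have := (Finset.mem_sdiff.1 hp).2
      simpa [hS] using this
    have e1 : ∏ p ∈ T \ S, ((B p).card : ℝ) / ((p : ℕ) : ℝ)^2 =
        ∏ p ∈ T \ S, (1 - ((redF (p : ℕ) P).card : ℝ) / ((p : ℕ) : ℝ)^2) := by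
      refine Finset.prod_congr rfl fun p hp => ?_
      rw [hBl p (hbig p hp), vpB_card]
    have e2 := vp_weierstrass (T \ S) (fun p : Nat.Primes => ((redF (p : ℕ) P).card : ℝ) / ((p : ℕ) : ℝ)^2)
      (fun p _ => by positivity) (fun p _ => vp_card_le_one p _)
    have e3 : ∑ p ∈ T \ S, ((redF (p : ℕ) P).card : ℝ) / ((p : ℕ) : ℝ)^2 ≤ 1 / 2 := by
      calc ∑ p ∈ T \ S, ((redF (p : ℕ) P).card : ℝ) / ((p : ℕ) : ℝ)^2
          ≤ ∑ p ∈ T \ S, (P.card : ℝ) * (((p : ℕ) : ℝ)^2)⁻¹ := by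
            refine Finset.sum_le_sum fun p _ => ?_
            rw [div_eq_mul_inv]
            gcongr
            exact vp_red_card_le P p
        _ = (P.card : ℝ) * ∑ p ∈ T \ S, (((p : ℕ) : ℝ)^2)⁻¹ := by rw [Finset.mul_sum]
        _ ≤ (P.card : ℝ) * (K:ℝ)⁻¹ := by
            gcongr
            exact vp_prime_tail _ K hK0 hbig
        _ ≤ 1 / 2 := by
            have hKr : (0:ℝ) < K := by exact_mod_cast hK0
            have : 2 * (P.card : ℝ) ≤ K := by exact_mod_cast hKP
            rw [← div_eq_mul_inv, div_le_iff₀ hKr]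
            linarith
    rw [e1]
    nlinarith
  · intro p hp t ht
    rw [hBl p hp, vpB_mem] at ht
    push Not at ht
    exact ht
  · intro t ht
    have hsmall : ∀ p : Nat.Primes, (p : ℕ) ≤ K → ∀ y : ℤ × ℤ,
        (((p : ℕ) : ℤ) ∣ (y + t).1 ∧ ((p : ℕ) : ℤ) ∣ (y + t).2) ↔
        (((p : ℕ) : ℤ) ∣ (y + t0).1 ∧ ((p : ℕ) : ℤ) ∣ (y + t0).2) := by
      intro p hp y
      have := ht p
      rw [hBs p hp, Finset.mem_singleton, Prod.mk.injEq] at this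
      simp only [← ZMod.intCast_zmod_eq_zero_iff_dvd, Prod.fst_add, Prod.snd_add, Int.cast_add,
        this.1, this.2]
    constructor
    · intro y hy
      rw [vp_vis_iff]
      intro p
      rcases le_or_gt (p : ℕ) K with hp | hp
      · rw [hsmall p hp]
        exact (vp_vis_iff _).1 (h1 y hy) p
      · have := ht p
        rw [hBl p hp, vpB_mem] at this
        exact this y hy
    · intro y hy hyP hv
      refine (vp_vis_iff _).1 hv (q y) ?_
      rw [hsmall _ (hqK y hy)]
      exact hq y hy hyP

open Classical in
lemma vpCnt_eq_sum (S : Set (ℤ × ℤ)) (R : ℝ) :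
    vpCnt S R = ∑ t ∈ (vpDisc_finite R).toFinset, if t ∈ S then (1:ℝ) else 0 := by
  rw [Finset.sum_boole, vpCnt]
  congr 1
  rw [← Set.ncard_coe_finset]
  congr 1
  ext t
  simp [and_comm]

open Classical in
lemma vp_incl_excl (P D : Finset (ℤ × ℤ)) (t : ℤ × ℤ) :
    ∑ F ∈ (D \ P).powerset, (-1 : ℝ)^F.card *
      (if t ∈ {t : ℤ × ℤ | ∀ y ∈ P ∪ F, y + t ∈ Vis} then (1:ℝ) else 0) =
    if t ∈ {t : ℤ × ℤ | (∀ y ∈ P, y + t ∈ Vis) ∧ (∀ y ∈ D, y ∉ P → y + t ∉ Vis)} then (1:ℝ) else 0 := by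
  set G := (D \ P).filter fun y => y + t ∈ Vis with hG
  simp only [mul_ite, mul_one, mul_zero, Set.mem_ofPred_eq]
  rw [← Finset.sum_filter]
  by_cases hP : ∀ y ∈ P, y + t ∈ Vis
  · have e : ((D \ P).powerset.filter fun F => ∀ y ∈ P ∪ F, y + t ∈ Vis) = G.powerset := by
      ext F
      simp only [Finset.mem_filter, Finset.mem_powerset, Finset.mem_union, hG]
      constructor
      · rintro ⟨h1, h2⟩ y hy
        exact Finset.mem_filter.2 ⟨h1 hy, h2 y (Or.inr hy)⟩
      · intro h
        refine ⟨fun y hy => (Finset.mem_filter.1 (h hy)).1, ?_⟩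
        rintro y (hy | hy)
        · exact hP y hy
        · exact (Finset.mem_filter.1 (h hy)).2
    rw [e]
    have hs : ∑ F ∈ G.powerset, (-1 : ℝ)^F.card = ((∑ F ∈ G.powerset, (-1 : ℤ)^F.card : ℤ) : ℝ) := by
      push_cast; rfl
    rw [hs, Finset.sum_powerset_neg_one_pow_card]
    push_cast
    refine if_congr ?_ rfl rfl
    rw [hG, Finset.filter_eq_empty_iff]
    simp only [Finset.mem_sdiff]
    tauto
  · rw [if_neg (by tauto)]
    refine Finset.sum_eq_zero fun F hF => ?_
    exact absurd (fun y hy => (Finset.mem_filter.1 hF).2 y (Finset.mem_union_left _ hy)) hP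

/-- Any `ρ`-patch `P` of the visible points occurs with positive frequency, given by
`ν(P) = Σ_{F ⊆ (ℤ²∩B_ρ(0))\P} (−1)^{|F|} ∏_p (1 − |(P∪F)_p|/p²)`.  Here `D` is the
finite set `ℤ² ∩ B_ρ(0)`. -/
theorem visible_patch_frequency (ρ : ℝ) (hρ : 0 < ρ) (P D : Finset (ℤ × ℤ))
    (hD : ∀ y : ℤ × ℤ, y ∈ D ↔ (y.1 : ℝ)^2 + (y.2 : ℝ)^2 < ρ^2)
    (hP : ∃ t : ℤ × ℤ, ∀ y : ℤ × ℤ,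
      y ∈ P ↔ (y + t ∈ Vis ∧ (y.1 : ℝ)^2 + (y.2 : ℝ)^2 < ρ^2)) :
    0 < ∑ F ∈ (D \ P).powerset, (-1 : ℝ)^F.card *
        ∏' p : Nat.Primes, (1 - ((redF (p : ℕ) (P ∪ F)).card : ℝ) / ((p : ℕ) : ℝ)^2) ∧
    Tendsto (fun R : ℝ =>
        (Nat.card {t : ℤ × ℤ //
          (∀ y : ℤ × ℤ, (y + t ∈ Vis ∧ (y.1 : ℝ)^2 + (y.2 : ℝ)^2 < ρ^2) ↔ y ∈ P) ∧
          (t.1 : ℝ)^2 + (t.2 : ℝ)^2 < R^2} : ℝ) / (Real.pi * R^2))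
      atTop
      (𝓝 (∑ F ∈ (D \ P).powerset, (-1 : ℝ)^F.card *
        ∏' p : Nat.Primes, (1 - ((redF (p : ℕ) (P ∪ F)).card : ℝ) / ((p : ℕ) : ℝ)^2))) := by
  classical
  obtain ⟨t0, ht0⟩ := hP
  simp only [← hD] at ht0 ⊢
  have hPD : ∀ y ∈ P, y ∈ D := fun y hy => ((ht0 y).1 hy).2
  set W : Set (ℤ × ℤ) := {t : ℤ × ℤ | (∀ y ∈ P, y + t ∈ Vis) ∧ (∀ y ∈ D, y ∉ P → y + t ∉ Vis)} with hW
  have hlim : VpDens W (∑ F ∈ (D \ P).powerset, (-1 : ℝ)^F.card *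
        ∏' p : Nat.Primes, (1 - ((redF (p : ℕ) (P ∪ F)).card : ℝ) / ((p : ℕ) : ℝ)^2)) := by
    have h3 := tendsto_finsetSum (D \ P).powerset fun F _ =>
      (show Tendsto _ _ _ from vp_visible_dens (P ∪ F)).const_mul ((-1 : ℝ)^F.card)
    refine h3.congr fun R => ?_
    rw [vpCnt_eq_sum W]
    simp only [hW, ← vp_incl_excl P D]
    rw [Finset.sum_comm, Finset.sum_div]
    refine Finset.sum_congr rfl fun F _ => ?_
    rw [vpCnt_eq_sum, ← Finset.mul_sum, mul_div_assoc]
    congr!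
  constructor
  · obtain ⟨X, d, hd, hXd, hX⟩ := vp_pos_dens P D t0 (fun y hy => ((ht0 y).1 hy).1)
      (fun y hy hyP hv => hyP ((ht0 y).2 ⟨hv, hy⟩))
    refine hd.trans_le (le_of_tendsto_of_tendsto' hXd hlim fun R => ?_)
    have := Real.pi_pos
    gcongr
    exact vpCnt_mono (fun t ht => hX t ht) R
  · refine hlim.congr fun R => ?_
    congr 1
    rw [vpCnt, ← Nat.card_coe_set_eq, Nat.cast_inj]
    refine Nat.card_congr (Equiv.subtypeEquivRight fun t => ?_)
    simp only [hW, Set.mem_inter_iff, Set.mem_ofPred_eq, vpDisc]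
    refine and_congr_left fun _ => ?_
    constructor
    · rintro ⟨h1, h2⟩ y
      constructor
      · rintro ⟨hv, hy⟩
        by_contra hyP
        exact h2 y hy hyP hv
      · intro hy
        exact ⟨h1 y hy, hPD y hy⟩
    · intro h
      exact ⟨fun y hy => ((h y).2 hy).1, fun y hy hyP hv => hyP ((h y).1 ⟨hv, hy⟩)⟩
end
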